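/- arXiv:2402.17857 — 2 statements merged into one kernel-verified Lean document; each statement's English description precedes it below -/
import Mathlib

section
/- For every integer r ≥ 1, there exists D₀ such that the following holds. Let 𝒢 = (A,B) be a bipartite r-bounded multi-hypergraph (every edge has size at most r and contains exactly one vertex of A). Let A₁,…,A_k be a partition of A, and let 𝒢ᵢ = 𝒢[Aᵢ ∪ B]. If there exist reals Dᵢ ≥ D₀ for all i ∈ [k] such that every vertex of Aᵢ has degree at least 8·r·k·Dᵢ in 𝒢ᵢ and every vertex of B has degree at most Dᵢ in 𝒢ᵢ, then there exists an A-perfect matching of 𝒢. -/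
open Classical in
/-- Independent partial transversals with support exactly `T`. -/
noncomputable def FF {V ι : Type} [Fintype ι] (α : ι → V) (C : ι → ι → Prop) (T : Finset V) :
    Finset (Finset ι) :=
  Finset.univ.filter (fun M => (∀ x ∈ M, ∀ y ∈ M, x ≠ y → α x ≠ α y ∧ ¬ C x y) ∧ M.image α = T)

open Classical in
noncomputable def dg {V ι : Type} [Fintype ι] (α : ι → V) (a : V) : Finset ι :=
  Finset.univ.filter (fun i => α i = a)

open Classical in
lemma sum_biUnion_le_aux {V ι : Type} (s : Finset V) (t : V → Finset ι) (g : ι → ℝ)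
    (hg : ∀ i, 0 ≤ g i) : ∑ f ∈ s.biUnion t, g f ≤ ∑ b ∈ s, ∑ f ∈ t b, g f := by
  induction s using Finset.induction_on with
  | empty => simp
  | insert a s ha ih =>
    rw [Finset.biUnion_insert, Finset.sum_insert ha]
    have h1 := Finset.sum_union_inter (s₁ := t a) (s₂ := s.biUnion t) (f := g)
    have h2 : 0 ≤ ∑ f ∈ t a ∩ s.biUnion t, g f := Finset.sum_nonneg fun i _ => hg i
    linarith

open Classical in
lemma FF_erase {V ι : Type} [Fintype ι] (α : ι → V) (C : ι → ι → Prop) (T : Finset V) (f : ι) :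
    ((FF α C T).filter (fun M => f ∈ M)).card ≤ (FF α C (T.erase (α f))).card := by
  apply Finset.card_le_card_of_injOn (fun M => M.erase f)
  · intro M hM
    simp only [FF, Finset.coe_filter, Finset.mem_filter, Finset.mem_univ, true_and,
      Set.mem_ofPred_eq] at hM ⊢
    obtain ⟨⟨h1, h2⟩, h3⟩ := hM
    refine ⟨fun x hx y hy => h1 x (Finset.mem_of_mem_erase hx) y (Finset.mem_of_mem_erase hy), ?_⟩
    ext v
    simp only [Finset.mem_image, Finset.mem_erase, ← h2]
    constructor
    · rintro ⟨x, ⟨hx, hxM⟩, rfl⟩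
      exact ⟨(h1 x hxM f h3 hx).1, x, hxM, rfl⟩
    · rintro ⟨hv, x, hx, rfl⟩
      exact ⟨x, ⟨fun h => hv (by rw [h]), hx⟩, rfl⟩
  · intro M hM M' hM' h
    simp only [Finset.coe_filter, Set.mem_ofPred_eq] at hM hM'
    have := congrArg (insert f) h
    simpa [Finset.insert_erase hM.2, Finset.insert_erase hM'.2] using this

open Classical in
lemma FF_step {V ι : Type} [Fintype ι] (α : ι → V) (C : ι → ι → Prop)
    (hC : ∀ x y, C x y → C y x)
    (h : ∀ e, ∑ f ∈ Finset.univ.filter (fun f => C e f), (1 : ℝ) / (dg α (α f)).card ≤ 1 / 4)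
    (n : ℕ) : ∀ T : Finset V, T.card = n → ∀ a, a ∉ T →
      ((dg α a).card : ℝ) * (FF α C T).card ≤ 2 * (FF α C (insert a T)).card := by
  induction n using Nat.strong_induction_on with
  | _ n ih =>
  intro T hT a ha
  set N : ℝ := (((FF α C T).card : ℕ) : ℝ) with hN
  have key : ∀ f, (((FF α C T).filter (fun M => f ∈ M)).card : ℝ)
      ≤ 2 * N * (1 / (dg α (α f)).card) := by
    intro f
    by_cases hf : α f ∈ T
    · have h1 : (((FF α C T).filter (fun M => f ∈ M)).card : ℝ)
        ≤ (FF α C (T.erase (α f))).card := by exact_mod_cast FF_erase α C T f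
      have h2 := ih (T.erase (α f)).card (by rw [← hT]; exact Finset.card_erase_lt_of_mem hf)
        (T.erase (α f)) rfl (α f) (by simp)
      rw [Finset.insert_erase hf] at h2
      have hpos : (0 : ℝ) < (dg α (α f)).card := by
        exact_mod_cast Finset.card_pos.mpr ⟨f, by simp [dg]⟩
      rw [mul_one_div, le_div_iff₀ hpos]
      nlinarith
    · have : (FF α C T).filter (fun M => f ∈ M) = ∅ := by
        apply Finset.filter_eq_empty_iff.mpr
        intro M hM hfM
        simp only [FF, Finset.mem_filter, Finset.mem_univ, true_and] at hM
        exact hf (hM.2 ▸ Finset.mem_image_of_mem α hfM)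
      rw [this]
      simp only [Finset.card_empty, Nat.cast_zero]
      positivity
  set good := ((dg α a) ×ˢ (FF α C T)).filter (fun p => ∀ f ∈ p.2, ¬ C p.1 f) with hgood
  set bad := ((dg α a) ×ˢ (FF α C T)).filter (fun p => ¬ ∀ f ∈ p.2, ¬ C p.1 f) with hbad
  have hsum : good.card + bad.card = (dg α a).card * (FF α C T).card := by
    rw [← Finset.card_product]
    exact Finset.card_filter_add_card_filter_not _
  have hg : good.card ≤ (FF α C (insert a T)).card := by
    apply Finset.card_le_card_of_injOn (fun p => insert p.1 p.2)
    · rintro ⟨e, M⟩ hp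
      simp only [hgood, dg, FF, Finset.coe_filter, Finset.mem_product, Finset.mem_filter,
        Finset.mem_univ, true_and, Set.mem_ofPred_eq] at hp ⊢
      obtain ⟨⟨h1, h2, h3⟩, h4⟩ := hp
      have hne : ∀ x ∈ M, α x ≠ a := by
        intro x hx hxa
        exact ha (h3 ▸ hxa ▸ Finset.mem_image_of_mem α hx)
      refine ⟨?_, by rw [Finset.image_insert, h1, h3]⟩
      intro x hx y hy hxy
      rw [Finset.mem_insert] at hx hy
      rcases hx with rfl | hx <;> rcases hy with rfl | hy
      · exact absurd rfl hxy
      · exact ⟨by rw [h1]; exact (hne y hy).symm, h4 y hy⟩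
      · exact ⟨by rw [h1]; exact (hne x hx), fun hc => h4 x hx (hC _ _ hc)⟩
      · exact h2 x hx y hy hxy
    · rintro ⟨e, M⟩ hp ⟨e', M'⟩ hp' heq
      simp only [hgood, dg, FF, Finset.coe_filter, Finset.mem_product, Finset.mem_filter,
        Finset.mem_univ, true_and, Set.mem_ofPred_eq] at hp hp' heq
      obtain ⟨⟨h1, h2, h3⟩, h4⟩ := hp
      obtain ⟨⟨h1', h2', h3'⟩, h4'⟩ := hp'
      have hne : ∀ x ∈ M, α x ≠ a := by
        intro x hx hxa
        exact ha (h3 ▸ hxa ▸ Finset.mem_image_of_mem α hx)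
      have hne' : ∀ x ∈ M', α x ≠ a := by
        intro x hx hxa
        exact ha (h3' ▸ hxa ▸ Finset.mem_image_of_mem α hx)
      have he : e = e' := by
        have : e ∈ insert e' M' := heq ▸ Finset.mem_insert_self e M
        rcases Finset.mem_insert.mp this with h | h
        · exact h
        · exact absurd h1 (hne' _ h)
      subst he
      have e1 : e ∉ M := fun h => hne _ h h1
      have e2 : e ∉ M' := fun h => hne' _ h h1
      have := congrArg (fun s => Finset.erase s e) heq
      simp only [Finset.erase_insert e1, Finset.erase_insert e2] at this
      rw [this]
  have hb : (bad.card : ℝ) ≤ (dg α a).card * (N / 2) := by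
    have hsub : bad ⊆ (dg α a).biUnion (fun e => (Finset.univ.filter (fun f => C e f)).biUnion
        (fun f => ((FF α C T).filter (fun M => f ∈ M)).image (fun M => (e, M)))) := by
      rintro ⟨e, M⟩ hp
      simp only [hbad, Finset.mem_filter, Finset.mem_product] at hp
      obtain ⟨⟨h1, h2⟩, h3⟩ := hp
      push Not at h3
      obtain ⟨f, hf, hc⟩ := h3
      simp only [Finset.mem_biUnion, Finset.mem_image, Finset.mem_filter, Finset.mem_univ, true_and]
      exact ⟨e, h1, f, hc, M, ⟨h2, hf⟩, rfl⟩
    have hcard : bad.card ≤ ∑ e ∈ dg α a, ∑ f ∈ Finset.univ.filter (fun f => C e f),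
        ((FF α C T).filter (fun M => f ∈ M)).card := by
      refine (Finset.card_le_card hsub).trans (Finset.card_biUnion_le.trans ?_)
      refine Finset.sum_le_sum fun e _ => Finset.card_biUnion_le.trans ?_
      exact Finset.sum_le_sum fun f _ => Finset.card_image_le
    calc (bad.card : ℝ) ≤ ∑ e ∈ dg α a, ∑ f ∈ Finset.univ.filter (fun f => C e f),
        (((FF α C T).filter (fun M => f ∈ M)).card : ℝ) := by exact_mod_cast hcard
      _ ≤ ∑ e ∈ dg α a, N / 2 := by
        refine Finset.sum_le_sum fun e _ => ?_
        calc _ ≤ ∑ f ∈ Finset.univ.filter (fun f => C e f), 2 * N * (1 / (dg α (α f)).card) :=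
              Finset.sum_le_sum fun f _ => key f
          _ ≤ N / 2 := by
            rw [← Finset.mul_sum]
            have := h e
            have hN0 : 0 ≤ N := by positivity
            nlinarith
      _ = _ := by simp
  have hsum' : (good.card : ℝ) + bad.card = (dg α a).card * N := by rw [hN]; exact_mod_cast hsum
  have hg' : (good.card : ℝ) ≤ (FF α C (insert a T)).card := by exact_mod_cast hg
  linarith

open Classical in
lemma FF_pos {V ι : Type} [Fintype ι] (α : ι → V) (C : ι → ι → Prop)
    (hC : ∀ x y, C x y → C y x)
    (h : ∀ e, ∑ f ∈ Finset.univ.filter (fun f => C e f), (1 : ℝ) / (dg α (α f)).card ≤ 1 / 4)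
    (T : Finset V) (hT : ∀ a ∈ T, 0 < (dg α a).card) : 0 < (FF α C T).card := by
  induction T using Finset.induction_on with
  | empty => exact Finset.card_pos.mpr ⟨∅, by simp [FF]⟩
  | insert a T ha ih =>
    have h1 := FF_step α C hC h T.card T rfl a ha
    have h2 := ih fun b hb => hT b (Finset.mem_insert_of_mem hb)
    have h3 := hT a (Finset.mem_insert_self a T)
    have h4 : (0 : ℝ) < (dg α a).card * (FF α C T).card := by positivity
    have h5 : (0 : ℝ) < (FF α C (insert a T)).card := by linarith
    exact_mod_cast h5

/-- Corollary on `A`-perfect matchings of bipartite `r`-bounded multi-hypergraphs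
with a partition of `A`.  The multi-hypergraph has edge index type `ι` with edge
map `E : ι → Finset V`; each edge has size at most `r`, is contained in `A ∪ B`,
and meets `A` in exactly one vertex.  `P : Fin k → Set V` is a partition of `A`,
and `𝒢ⱼ` consists of the edges whose `A`-vertex lies in `P j`. -/
theorem bipartite_matching_partitioned :
    ∀ r : ℕ, 1 ≤ r → ∃ D₀ : ℝ,
      ∀ (V ι : Type) [Fintype V] [Fintype ι] [DecidableEq V],
      ∀ (E : ι → Finset V) (A B : Set V) (k : ℕ) (P : Fin k → Set V) (D : Fin k → ℝ),
        Disjoint A B →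
        (∀ i, (E i).card ≤ r) →
        (∀ i, ↑(E i) ⊆ A ∪ B) →
        (∀ i, ∃ a, ((E i : Set V) ∩ A) = {a}) →
        (⋃ j, P j) = A →
        (Pairwise (Function.onFun Disjoint P)) →
        (∀ j, D₀ ≤ D j) →
        -- every vertex of `Aⱼ` has degree at least `8·r·k·Dⱼ` in `𝒢ⱼ`
        (∀ j : Fin k, ∀ a ∈ P j,
          8 * r * k * D j ≤ (({i : ι | a ∈ E i} : Set ι).ncard : ℝ)) →
        -- every vertex of `B` has degree at most `Dⱼ` in `𝒢ⱼ`
        (∀ j : Fin k, ∀ b ∈ B,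
          (({i : ι | b ∈ E i ∧ ∃ a ∈ P j, a ∈ E i} : Set ι).ncard : ℝ) ≤ D j) →
        ∃ M : Set ι,
          (∀ i ∈ M, ∀ i' ∈ M, i ≠ i' → Disjoint (E i) (E i')) ∧
          ∀ a ∈ A, ∃ i ∈ M, a ∈ E i := by
  classical
  intro r hr
  refine ⟨1, ?_⟩
  intro V ι _ _ _ E A B k P D hAB hcard hsub hone hP hdisj hD hA hB
  choose α hα using hone
  have hαE : ∀ i, α i ∈ E i ∧ α i ∈ A := by
    intro i
    have : α i ∈ (E i : Set V) ∩ A := by rw [hα i]; rfl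
    exact ⟨by simpa using this.1, this.2⟩
  have huniq : ∀ i a, a ∈ A → a ∈ E i → α i = a := by
    intro i a ha hi
    have : a ∈ (E i : Set V) ∩ A := ⟨by simpa using hi, ha⟩
    rw [hα i] at this
    exact (Set.mem_singleton_iff.mp this).symm
  have hPA : ∀ j a, a ∈ P j → a ∈ A := by
    intro j a h
    rw [← hP]; exact Set.mem_iUnion.mpr ⟨j, h⟩
  have hr0 : (1 : ℝ) ≤ r := by exact_mod_cast hr
  have hd : ∀ j a, a ∈ P j → 8 * r * k * D j ≤ ((dg α a).card : ℝ) := by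
    intro j a ha
    refine (hA j a ha).trans (le_of_eq ?_)
    rw [← Set.ncard_coe_finset]
    congr 2
    ext i
    simp only [Set.mem_ofPred_eq, dg, Finset.coe_filter, Finset.mem_univ, true_and]
    exact ⟨huniq i a (hPA j a ha), fun h => h ▸ (hαE i).1⟩
  have hk : ∀ j : Fin k, (1 : ℝ) ≤ k := fun j => by
    have := j.pos
    exact_mod_cast this
  have hpos : ∀ j, 0 < 8 * r * k * D j := by
    intro j
    have := hk j
    have := hD j
    positivity
  have hb : ∀ b ∈ B, ∑ f ∈ Finset.univ.filter (fun f => b ∈ E f),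
      (1 : ℝ) / (dg α (α f)).card ≤ 1 / (8 * r) := by
    intro b hbB
    have hsb : Finset.univ.filter (fun f => b ∈ E f) ⊆ (Finset.univ : Finset (Fin k)).biUnion
        (fun j => Finset.univ.filter (fun f => b ∈ E f ∧ α f ∈ P j)) := by
      intro f hf
      have := (hαE f).2
      rw [← hP] at this
      obtain ⟨j, hj⟩ := Set.mem_iUnion.mp this
      simp only [Finset.mem_biUnion, Finset.mem_filter, Finset.mem_univ, true_and] at hf ⊢
      exact ⟨j, hf, hj⟩
    calc _ ≤ ∑ f ∈ (Finset.univ : Finset (Fin k)).biUnion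
          (fun j => Finset.univ.filter (fun f => b ∈ E f ∧ α f ∈ P j)),
          (1 : ℝ) / (dg α (α f)).card :=
          Finset.sum_le_sum_of_subset_of_nonneg hsb (fun _ _ _ => by positivity)
      _ = ∑ j : Fin k, ∑ f ∈ Finset.univ.filter (fun f => b ∈ E f ∧ α f ∈ P j),
          (1 : ℝ) / (dg α (α f)).card := by
          apply Finset.sum_biUnion
          intro j _ j' _ hjj
          rw [Function.onFun, Finset.disjoint_left]
          intro f hf hf'
          simp only [Finset.mem_filter, Finset.mem_univ, true_and] at hf hf'
          exact Set.disjoint_left.mp (hdisj hjj) hf.2 hf'.2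
      _ ≤ ∑ j : Fin k, 1 / (8 * r * k : ℝ) := by
          refine Finset.sum_le_sum fun j _ => ?_
          have hc : ((Finset.univ.filter (fun f => b ∈ E f ∧ α f ∈ P j)).card : ℝ) ≤ D j := by
            refine le_trans (le_of_eq ?_) (hB j b hbB)
            rw [← Set.ncard_coe_finset]
            congr 2
            ext i
            simp only [Set.mem_ofPred_eq, Finset.coe_filter, Finset.mem_univ, true_and]
            refine and_congr_right fun _ => ⟨fun h => ⟨_, h, (hαE i).1⟩, ?_⟩
            rintro ⟨a, ha, hi⟩
            rwa [huniq i a (hPA j a ha) hi]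
          calc _ ≤ ∑ f ∈ Finset.univ.filter (fun f => b ∈ E f ∧ α f ∈ P j),
                1 / (8 * r * k * D j) := by
                refine Finset.sum_le_sum fun f hf => ?_
                simp only [Finset.mem_filter, Finset.mem_univ, true_and] at hf
                exact one_div_le_one_div_of_le (hpos j) (hd j _ hf.2)
            _ ≤ D j * (1 / (8 * r * k * D j)) := by
                rw [Finset.sum_const, nsmul_eq_mul]
                exact mul_le_mul_of_nonneg_right hc (one_div_pos.mpr (hpos j)).le
            _ = 1 / (8 * r * k : ℝ) := by
                have h1 := hk j
                have h2 := hD j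
                have : D j ≠ 0 := by positivity
                have : (k : ℝ) ≠ 0 := by positivity
                field_simp
      _ ≤ 1 / (8 * r) := by
          rw [Finset.sum_const, nsmul_eq_mul, Finset.card_univ, Fintype.card_fin]
          rcases Nat.eq_zero_or_pos k with h0 | h0
          · rw [h0]; simp
          · have : (k : ℝ) ≠ 0 := by positivity
            apply le_of_eq
            field_simp
  have hmain := FF_pos α (fun e f => ¬ Disjoint (E e) (E f) ∧ α e ≠ α f)
    (fun x y h => ⟨fun h' => h.1 h'.symm, h.2.symm⟩) ?_ A.toFinset ?_
  · obtain ⟨M, hM⟩ := Finset.card_pos.mp hmain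
    simp only [FF, Finset.mem_filter, Finset.mem_univ, true_and] at hM
    refine ⟨M, ?_, ?_⟩
    · intro i hi i' hi' hne
      have := hM.1 i hi i' hi' hne
      by_contra hc
      exact this.2 ⟨hc, this.1⟩
    · intro a ha
      have : a ∈ A.toFinset := by simpa using ha
      rw [← hM.2] at this
      simp only [Finset.mem_image] at this
      obtain ⟨i, hi, rfl⟩ := this
      exact ⟨i, hi, (hαE i).1⟩
  · intro e
    suffices hx : ∑ f ∈ Finset.univ.filter (fun f => ¬ Disjoint (E e) (E f) ∧ α e ≠ α f),
        (1 : ℝ) / (dg α (α f)).card ≤ 1 / 4 by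
      convert hx
    have hs : Finset.univ.filter (fun f => ¬ Disjoint (E e) (E f) ∧ α e ≠ α f) ⊆
        ((E e).filter (fun b => b ∈ B)).biUnion
          (fun b => Finset.univ.filter (fun f => b ∈ E f)) := by
      intro f hf
      simp only [Finset.mem_biUnion, Finset.mem_filter, Finset.mem_univ, true_and] at hf ⊢
      obtain ⟨h1, h2⟩ := hf
      obtain ⟨b, hb1, hb2⟩ := Finset.not_disjoint_iff.mp h1
      rcases hsub e (Finset.mem_coe.mpr hb1) with hbA | hbB
      · exact absurd ((huniq e b hbA hb1).trans (huniq f b hbA hb2).symm) h2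
      · exact ⟨b, ⟨hb1, hbB⟩, hb2⟩
    calc _ ≤ ∑ f ∈ ((E e).filter (fun b => b ∈ B)).biUnion
          (fun b => Finset.univ.filter (fun f => b ∈ E f)), (1 : ℝ) / (dg α (α f)).card :=
          Finset.sum_le_sum_of_subset_of_nonneg hs (fun _ _ _ => by positivity)
      _ ≤ ∑ b ∈ (E e).filter (fun b => b ∈ B), ∑ f ∈ Finset.univ.filter (fun f => b ∈ E f),
            (1 : ℝ) / (dg α (α f)).card := by
          refine le_trans (le_of_eq ?_) (sum_biUnion_le_aux _ _ _ fun _ => by positivity)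
          congr!
      _ ≤ ∑ b ∈ (E e).filter (fun b => b ∈ B), 1 / (8 * r : ℝ) :=
          Finset.sum_le_sum fun b hb' => hb b (Finset.mem_filter.mp hb').2
      _ ≤ r * (1 / (8 * r : ℝ)) := by
          rw [Finset.sum_const, nsmul_eq_mul]
          have : (((E e).filter (fun b => b ∈ B)).card : ℝ) ≤ r := by
            exact_mod_cast (Finset.card_filter_le _ _).trans (hcard e)
          exact mul_le_mul_of_nonneg_right this (by positivity)
      _ ≤ 1 / 4 := by
          have : (r : ℝ) ≠ 0 := by positivity
          have : (r : ℝ) * (1 / (8 * r : ℝ)) = 1 / 8 := by field_simp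
          rw [this]; norm_num
  · intro a ha
    have ha' : a ∈ A := by simpa using ha
    rw [← hP] at ha'
    obtain ⟨j, hj⟩ := Set.mem_iUnion.mp ha'
    have := (hpos j).trans_le (hd j a hj)
    exact_mod_cast this
end

section
/- For each integer q ≥ 3, the K_q-absorber rooted 2-density threshold satisfies d_abs(K_q) ≥ q − 1. -/
/-- The edges spanned by a clique with vertex set `S`. -/
def cliqueEdges {V : Type} (S : Finset V) : Set (Sym2 V) :=
  {f | ¬f.IsDiag ∧ ∀ v ∈ f, v ∈ S}

/-- A `K_q`-decomposition of a graph `G`. -/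
def IsKqDecomp {V : Type} (q : ℕ) (G : SimpleGraph V) (𝒟 : Set (Finset V)) : Prop :=
  (∀ S ∈ 𝒟, G.IsNClique q S) ∧
  ∀ e ∈ G.edgeSet, ∃! S, S ∈ 𝒟 ∧ e ∈ cliqueEdges S

/-- A graph is `K_q`-divisible. -/
def IsKqDivisible {V : Type} (q : ℕ) (G : SimpleGraph V) : Prop :=
  q.choose 2 ∣ G.edgeSet.ncard ∧ ∀ v : V, (q - 1) ∣ (G.neighborSet v).ncard

/-- `A` is a `K_q`-absorber for `L` with root set `VL`: the vertex set of `L`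
is contained in `VL`, `VL` is independent in `A`, and both `A` and `L ∪ A`
admit `K_q`-decompositions. -/
def IsAbsorber {V : Type} (q : ℕ) (L A : SimpleGraph V) (VL : Set V) : Prop :=
  L.support ⊆ VL ∧
  (∀ u ∈ VL, ∀ v ∈ VL, ¬A.Adj u v) ∧
  (∃ 𝒟, IsKqDecomp q A 𝒟) ∧
  (∃ 𝒟, IsKqDecomp q (L ⊔ A) 𝒟)

/-- The maximum rooted density `m(H,R)`. -/
noncomputable def rootedDensity {V : Type} (H : SimpleGraph V) (R : Set V) : ℝ :=
  sSup {x : ℝ | ∃ H' : H.Subgraph, (H'.verts \ R).Nonempty ∧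
    x = (H'.edgeSet.ncard : ℝ) / ((H'.verts \ R).ncard : ℝ)}

/-- The maximum 2-density `m₂(H)`. -/
noncomputable def density2 {V : Type} (H : SimpleGraph V) : ℝ :=
  sSup {x : ℝ | ∃ H' : H.Subgraph, 3 ≤ H'.verts.ncard ∧
    x = ((H'.edgeSet.ncard : ℝ) - 1) / ((H'.verts.ncard : ℝ) - 2)}

/-- The maximum rooted 2-density `m₂(H,R)`. -/
noncomputable def rootedDensity2 {V : Type} (H : SimpleGraph V) (R : Set V) : ℝ :=
  max (rootedDensity H R) (density2 H)

/-- `r` is an admissible rooted 2-density bound for `K_q`-absorbers: for every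
`C₁` there is `C₂` such that every `K_q`-divisible graph on at most `C₁`
vertices has a `K_q`-absorber on at most `C₂` vertices with maximum rooted
2-density at the roots at most `r`. -/
def AbsorbsAll (q : ℕ) (r : ℝ) : Prop :=
  ∀ C₁ : ℕ, 0 < C₁ → ∃ C₂ : ℕ, 0 < C₂ ∧
    ∀ L : SimpleGraph (Fin C₁), IsKqDivisible q L →
      ∃ (φ : Fin C₁ ↪ Fin C₂) (A : SimpleGraph (Fin C₂)),
        IsAbsorber q (L.map φ) A (Set.range φ) ∧
        rootedDensity2 A (Set.range φ) ≤ r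

/-- The `K_q`-absorber rooted 2-density threshold `d_abs(K_q)`. -/
noncomputable def absorberThreshold (q : ℕ) : ℝ :=
  sInf {r : ℝ | 0 < r ∧ AbsorbsAll q r}

open Classical in
def KDec {V : Type} (q : ℕ) (G : SimpleGraph V) : Prop := ∃ 𝒟, IsKqDecomp q G 𝒟

theorem decomp_iff {V : Type} {q : ℕ} {G : SimpleGraph V} {𝒟 : Set (Finset V)} :
    IsKqDecomp q G 𝒟 ↔ (∀ S ∈ 𝒟, G.IsNClique q S) ∧
      ∀ u v, G.Adj u v → ∃! S, S ∈ 𝒟 ∧ u ∈ S ∧ v ∈ S := by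
  unfold IsKqDecomp
  refine and_congr_right fun _ => ?_
  constructor
  · intro h u v huv
    have := h s(u, v) huv
    simpa [cliqueEdges, huv.ne] using this
  · intro h e
    induction e with
    | _ u v =>
      intro huv
      have huv' : G.Adj u v := huv
      simpa [cliqueEdges, huv'.ne] using h u v huv'

theorem nclique_adj {V : Type} {q : ℕ} {G : SimpleGraph V} {S : Finset V}
    (h : G.IsNClique q S) {u v : V} (hu : u ∈ S) (hv : v ∈ S) (huv : u ≠ v) : G.Adj u v :=
  h.1 hu hv huv

def Dj {V : Type} (G H : SimpleGraph V) : Prop := ∀ u v, G.Adj u v → H.Adj u v → False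

theorem KDec.sup {V : Type} {q : ℕ} {G H : SimpleGraph V} (hG : KDec q G) (hH : KDec q H)
    (hd : Dj G H) : KDec q (G ⊔ H) := by
  obtain ⟨D, hD⟩ := hG
  obtain ⟨E, hE⟩ := hH
  rw [decomp_iff] at hD hE
  refine ⟨D ∪ E, decomp_iff.2 ⟨?_, ?_⟩⟩
  · rintro S (hS | hS)
    · exact (hD.1 S hS).mono le_sup_left
    · exact (hE.1 S hS).mono le_sup_right
  · rintro u v (huv | huv)
    · obtain ⟨S, hS, hu⟩ := hD.2 u v huv
      refine ⟨S, ⟨Or.inl hS.1, hS.2⟩, ?_⟩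
      rintro S' ⟨h1 | h1, h2, h3⟩
      · exact hu S' ⟨h1, h2, h3⟩
      · exact (hd u v huv (nclique_adj (hE.1 S' h1) h2 h3 huv.ne)).elim
    · obtain ⟨S, hS, hu⟩ := hE.2 u v huv
      refine ⟨S, ⟨Or.inr hS.1, hS.2⟩, ?_⟩
      rintro S' ⟨h1 | h1, h2, h3⟩
      · exact (hd u v (nclique_adj (hD.1 S' h1) h2 h3 huv.ne) huv).elim
      · exact hu S' ⟨h1, h2, h3⟩

theorem KDec.bot {V : Type} {q : ℕ} : KDec q (⊥ : SimpleGraph V) :=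
  ⟨∅, decomp_iff.2 ⟨by simp, by simp⟩⟩

/-- clique on `S` minus edges inside `X`. -/
def Vg {V : Type} (X C : Finset V) : SimpleGraph V where
  Adj u v := u ≠ v ∧ u ∈ C ∧ v ∈ C ∧ ¬ (u ∈ X ∧ v ∈ X)
  symm := ⟨fun u v h => ⟨h.1.symm, h.2.2.1, h.2.1, fun h' => h.2.2.2 h'.symm⟩⟩
  loopless := ⟨fun _ h => h.1 rfl⟩

theorem Vg_adj {V : Type} {X C : Finset V} {u v : V} :
    (Vg X C).Adj u v ↔ u ≠ v ∧ u ∈ C ∧ v ∈ C ∧ ¬ (u ∈ X ∧ v ∈ X) := Iff.rfl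

theorem KDec.clique {V : Type} {q : ℕ} (C : Finset V) (hC : C.card = q) :
    KDec q (Vg ∅ C) := by
  refine ⟨{C}, decomp_iff.2 ⟨?_, ?_⟩⟩
  · rintro S rfl
    refine ⟨?_, hC⟩
    intro u hu v hv huv
    exact ⟨huv, hu, hv, by simp⟩
  · intro u v huv
    refine ⟨C, ⟨rfl, huv.2.1, huv.2.2.1⟩, ?_⟩
    rintro S ⟨rfl, _⟩
    rfl

/-- remove cliques -/
theorem KDec.remove {V : Type} {q : ℕ} {G G' : SimpleGraph V} {𝒟 𝒮 : Set (Finset V)}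
    (h : IsKqDecomp q G 𝒟) (hs : 𝒮 ⊆ 𝒟)
    (hG : ∀ u v, G'.Adj u v ↔ G.Adj u v ∧ ∀ S ∈ 𝒮, ¬ (u ∈ S ∧ v ∈ S)) : KDec q G' := by
  rw [decomp_iff] at h
  refine ⟨𝒟 \ 𝒮, decomp_iff.2 ⟨?_, ?_⟩⟩
  · intro S hS
    refine ⟨?_, (h.1 S hS.1).2⟩
    intro u hu v hv huv
    have hadj := nclique_adj (h.1 S hS.1) hu hv huv
    refine (hG u v).2 ⟨hadj, fun S' hS' hh => hS.2 ?_⟩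
    have := (h.2 u v hadj).unique ⟨hS.1, hu, hv⟩ ⟨hs hS', hh⟩
    exact this ▸ hS'
  · intro u v huv
    have h2 := (hG u v).1 huv
    obtain ⟨S, hS, hu⟩ := h.2 u v h2.1
    refine ⟨S, ⟨⟨hS.1, fun h' => h2.2 S h' hS.2⟩, hS.2⟩, ?_⟩
    rintro S' ⟨h3, h4⟩
    exact hu S' ⟨h3.1, h4⟩

theorem decomp_map {T V : Type} {q : ℕ} {F : SimpleGraph T} {𝒟 : Set (Finset T)} (f : T ↪ V)
    (h : IsKqDecomp q F 𝒟) : IsKqDecomp q (F.map f) ((fun S => S.map f) '' 𝒟) := by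
  rw [decomp_iff] at h ⊢
  constructor
  · rintro _ ⟨S, hS, rfl⟩
    exact (h.1 S hS).map
  · intro u v huv
    rw [SimpleGraph.map_adj] at huv
    obtain ⟨a, b, hab, rfl, rfl⟩ := huv
    obtain ⟨S, hS, hu⟩ := h.2 a b hab
    refine ⟨S.map f, ⟨⟨S, hS.1, rfl⟩, by simpa using hS.2.1, by simpa using hS.2.2⟩, ?_⟩
    rintro _ ⟨⟨S', hS', rfl⟩, h1, h2⟩
    have : S' = S := hu S' ⟨hS', by simpa using h1, by simpa using h2⟩
    simp [this]

theorem KDec.map {T V : Type} {q : ℕ} {F : SimpleGraph T} (f : T ↪ V)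
    (h : KDec q F) : KDec q (F.map f) := by
  obtain ⟨D, hD⟩ := h
  exact ⟨_, decomp_map f hD⟩

theorem KDec.comap {T V : Type} {q : ℕ} (hq : 2 ≤ q) {G : SimpleGraph V} (f : T ↪ V)
    (h : KDec q G) (hs : ∀ u v, G.Adj u v → u ∈ Set.range f) : KDec q (G.comap f) := by
  obtain ⟨D, hD⟩ := h
  rw [decomp_iff] at hD
  refine ⟨{S | S.map f ∈ D}, decomp_iff.2 ⟨?_, ?_⟩⟩
  · intro S hS
    have := hD.1 _ hS
    refine ⟨?_, by simpa using this.2⟩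
    intro u hu v hv huv
    exact this.1 (by simpa using hu) (by simpa using hv) (by simpa using huv)
  · intro u v huv
    obtain ⟨S, hS, hu⟩ := hD.2 (f u) (f v) huv
    have hr : ∀ x ∈ S, x ∈ Set.range f := by
      intro x hx
      by_cases hxu : x = f u
      · exact ⟨u, hxu.symm⟩
      · exact hs x (f u) (nclique_adj (hD.1 S hS.1) hx hS.2.1 hxu)
    have hS' : (S.preimage f f.injective.injOn).map f = S := by
      ext x
      simp only [Finset.mem_map, Finset.mem_preimage]
      constructor
      · rintro ⟨a, ha, rfl⟩; exact ha
      · intro hx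
        obtain ⟨a, rfl⟩ := hr x hx
        exact ⟨a, hx, rfl⟩
    refine ⟨S.preimage f f.injective.injOn, ⟨by simpa [hS'] using hS.1, by simpa using hS.2.1,
      by simpa using hS.2.2⟩, ?_⟩
    rintro S2 ⟨h1, h2, h3⟩
    have := hu (S2.map f) ⟨h1, by simpa using h2, by simpa using h3⟩
    apply Finset.map_injective f
    rw [this, hS']

/-! ### Witnesses -/

open Classical in
structure Wit {V : Type} (d : ℕ) (Z : Finset V) (A : SimpleGraph V) (N : Finset V) : Prop where
  disj : ∀ v ∈ N, v ∉ Z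
  supp : ∀ u v, A.Adj u v → u ∈ N ∪ Z
  touch : ∀ u v, A.Adj u v → u ∈ N ∨ v ∈ N
  dens : ∀ T : Finset V, {e | e ∈ A.edgeSet ∧ ∀ v ∈ e, v ∈ T}.ncard ≤ d * (T ∩ N).card

theorem edges_in_finite {V : Type} (A : SimpleGraph V) (T : Finset V) :
    {e | e ∈ A.edgeSet ∧ ∀ v ∈ e, v ∈ T}.Finite := by
  classical
  refine (T.sym2.finite_toSet).subset ?_
  rintro e ⟨_, he⟩
  simpa only [Finset.mem_coe, Finset.mem_sym2_iff] using he

open Classical in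
theorem Wit.union {V : Type} {d : ℕ} {Z : Finset V} {A A' : SimpleGraph V} {N N' : Finset V}
    (h : Wit d Z A N) (h' : Wit d (Z ∪ N) A' N') : Wit d Z (A ⊔ A') (N ∪ N') := by
  refine ⟨?_, ?_, ?_, ?_⟩
  · intro v hv
    rcases Finset.mem_union.1 hv with hv | hv
    · exact h.disj v hv
    · have := h'.disj v hv
      grind
  · rintro u v (huv | huv)
    · have := h.supp u v huv
      grind
    · have := h'.supp u v huv
      grind
  · rintro u v (huv | huv)
    · have := h.touch u v huv
      grind
    · have := h'.touch u v huv
      grind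
  · intro T
    have h1 : {e | e ∈ (A ⊔ A').edgeSet ∧ ∀ v ∈ e, v ∈ T} ⊆
      {e | e ∈ A.edgeSet ∧ ∀ v ∈ e, v ∈ T} ∪ {e | e ∈ A'.edgeSet ∧ ∀ v ∈ e, v ∈ T} := by
      rintro e ⟨he, h2⟩
      rw [SimpleGraph.edgeSet_sup] at he
      rcases he with he | he
      · exact Or.inl ⟨he, h2⟩
      · exact Or.inr ⟨he, h2⟩
    have h2 := Set.ncard_le_ncard h1 ((edges_in_finite A T).union (edges_in_finite A' T))
    have h3 := Set.ncard_union_le {e | e ∈ A.edgeSet ∧ ∀ v ∈ e, v ∈ T}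
      {e | e ∈ A'.edgeSet ∧ ∀ v ∈ e, v ∈ T}
    have h4 : (T ∩ (N ∪ N')).card = (T ∩ N).card + (T ∩ N').card := by
      rw [Finset.inter_union_distrib_left, Finset.card_union_of_disjoint]
      rw [Finset.disjoint_left]
      intro v hv hv'
      have := h'.disj v (Finset.mem_inter.1 hv').2
      grind
    have h5 := h.dens T
    have h6 := h'.dens T
    rw [h4, mul_add]
    omega

open Classical in
theorem Wit.of_degree {V : Type} {d : ℕ} {Z : Finset V} {A : SimpleGraph V} {N : Finset V}
    (disj : ∀ v ∈ N, v ∉ Z)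
    (supp : ∀ u v, A.Adj u v → u ∈ N ∪ Z)
    (touch : ∀ u v, A.Adj u v → u ∈ N ∨ v ∈ N)
    (deg : ∀ u ∈ N, ∃ O : Finset V, O.card ≤ d ∧ ∀ v, A.Adj u v → v ∈ O) : Wit d Z A N := by
  refine ⟨disj, supp, touch, ?_⟩
  intro T
  choose! O hO hO' using deg
  have h1 : {e | e ∈ A.edgeSet ∧ ∀ v ∈ e, v ∈ T} ⊆
      (((T ∩ N).biUnion fun u => (O u).image fun v => s(u, v) : Finset (Sym2 V)) : Set (Sym2 V)) := by
    rintro e ⟨he, h2⟩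
    induction e with
    | _ u v =>
      have hadj : A.Adj u v := he
      simp only [Finset.coe_biUnion, Set.mem_iUnion, Finset.mem_coe, Finset.mem_image]
      rcases touch u v hadj with hu | hu
      · exact ⟨u, Finset.mem_inter.2 ⟨h2 u (by simp), hu⟩, v, hO' u hu v hadj, rfl⟩
      · exact ⟨v, Finset.mem_inter.2 ⟨h2 v (by simp), hu⟩, u, hO' v hu u hadj.symm, Sym2.eq_swap⟩
  have h2 := Set.ncard_le_ncard h1 (Finset.finite_toSet _)
  rw [Set.ncard_coe_finset] at h2
  refine h2.trans ?_
  rw [mul_comm]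
  apply Finset.card_biUnion_le_card_mul
  intro u hu
  exact Finset.card_image_le.trans (hO u (Finset.mem_inter.1 hu).2)

theorem Wit.bot {V : Type} {d : ℕ} {Z : Finset V} : Wit d Z ⊥ ∅ :=
  Wit.of_degree (by simp) (by simp) (by simp) (by simp)

/-- supported in -/
def SIn {V : Type} (Z : Finset V) (G : SimpleGraph V) : Prop := ∀ u v, G.Adj u v → u ∈ Z

theorem Wit.dj {V : Type} {d : ℕ} {Z : Finset V} {A G : SimpleGraph V} {N : Finset V}
    (h : Wit d Z A N) (hG : SIn Z G) : Dj A G := by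
  intro u v h1 h2
  rcases h.touch u v h1 with h3 | h3
  · exact h.disj u h3 (hG u v h2)
  · exact h.disj v h3 (hG v u h2.symm)

theorem Dj.symm {V : Type} {G H : SimpleGraph V} (h : Dj G H) : Dj H G :=
  fun u v h1 h2 => h u v h2 h1

theorem Dj.sup_left {V : Type} {G H K : SimpleGraph V} (h : Dj G K) (h' : Dj H K) :
    Dj (G ⊔ H) K := by
  rintro u v (h1 | h1) h2
  · exact h u v h1 h2
  · exact h' u v h1 h2

theorem Dj.sup_right {V : Type} {G H K : SimpleGraph V} (h : Dj K G) (h' : Dj K H) :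
    Dj K (G ⊔ H) := (Dj.sup_left h.symm h'.symm).symm

theorem SIn.mono {V : Type} {Z Z' : Finset V} {G : SimpleGraph V} (h : SIn Z G) (hz : Z ⊆ Z') :
    SIn Z' G := fun u v huv => hz (h u v huv)

theorem SIn.sup {V : Type} {Z : Finset V} {G H : SimpleGraph V} (h : SIn Z G) (h' : SIn Z H) :
    SIn Z (G ⊔ H) := by
  rintro u v (h1 | h1)
  · exact h u v h1
  · exact h' u v h1

open Classical in
theorem Wit.sIn {V : Type} {d : ℕ} {Z : Finset V} {A : SimpleGraph V} {N : Finset V}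
    (h : Wit d Z A N) : SIn (Z ∪ N) A := by
  intro u v huv
  have := h.supp u v huv
  grind

def Tr {V : Type} (q d : ℕ) (Z : Finset V) (G H : SimpleGraph V) : Prop :=
  ∃ A N, Wit d Z A N ∧ KDec q (A ⊔ G) ∧ KDec q (A ⊔ H)

theorem Tr.symm {V : Type} {q d : ℕ} {Z : Finset V} {G H : SimpleGraph V}
    (h : Tr q d Z G H) : Tr q d Z H G := by
  obtain ⟨A, N, h1, h2, h3⟩ := h
  exact ⟨A, N, h1, h3, h2⟩

theorem Tr.bot {V : Type} {q d : ℕ} {Z : Finset V} : Tr q d Z ⊥ ⊥ :=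
  ⟨⊥, ∅, Wit.bot, by simpa using KDec.bot, by simpa using KDec.bot⟩

theorem Tr.add {V : Type} {q d : ℕ} {Z : Finset V} {G H G' H' : SimpleGraph V}
    (h : Tr q d Z G H) (h' : ∀ Z', Z ⊆ Z' → Tr q d Z' G' H')
    (hG : SIn Z G) (hH : SIn Z H) (hG' : SIn Z G') (hH' : SIn Z H')
    (d1 : Dj G G') (d2 : Dj H H') : Tr q d Z (G ⊔ G') (H ⊔ H') := by
  classical
  obtain ⟨A, N, w, h2, h3⟩ := h
  obtain ⟨A', N', w', h2', h3'⟩ := h' (Z ∪ N) Finset.subset_union_left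
  have e : ∀ G G' : SimpleGraph V, (A ⊔ A') ⊔ (G ⊔ G') = (A ⊔ G) ⊔ (A' ⊔ G') := by
    intro G G'; ac_rfl
  have hs : Z ⊆ Z ∪ N := Finset.subset_union_left
  have dA := (w'.dj w.sIn).symm
  refine ⟨A ⊔ A', N ∪ N', w.union w', ?_, ?_⟩
  · rw [e]
    exact h2.sup h2' (Dj.sup_left (Dj.sup_right dA (w.dj hG'))
      (Dj.sup_right (w'.dj (hG.mono hs)).symm d1))
  · rw [e]
    exact h3.sup h3' (Dj.sup_left (Dj.sup_right dA (w.dj hH'))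
      (Dj.sup_right (w'.dj (hH.mono hs)).symm d2))

open Classical in
theorem Tr.glue {V : Type} {q d : ℕ} {Z N0 : Finset V} {G H G' H' : SimpleGraph V}
    (h1 : Tr q d (Z ∪ N0) (G ⊔ H') (G' ⊔ H))
    (h2 : ∀ Z', Z ∪ N0 ⊆ Z' → Tr q d Z' H H')
    (w0 : Wit d Z (H ⊔ H') N0)
    (hG : SIn Z G) (hG' : SIn Z G') (d3 : Dj H H') : Tr q d Z G G' := by
  obtain ⟨A, N, w, h3, h4⟩ := h1
  obtain ⟨A', N', w', h3', h4'⟩ := h2 (Z ∪ N0 ∪ N) Finset.subset_union_left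
  have hs : Z ⊆ Z ∪ N0 := Finset.subset_union_left
  have hs' : Z ∪ N0 ⊆ Z ∪ N0 ∪ N := Finset.subset_union_left
  have d0 := (w0.dj hG).symm
  have d0' := (w0.dj hG').symm
  have sH : SIn (Z ∪ N0) H := fun u v huv => w0.sIn u v (Or.inl huv)
  have sH' : SIn (Z ∪ N0) H' := fun u v huv => w0.sIn u v (Or.inr huv)
  have d1 : Dj G H := fun u v a b => d0 u v a (Or.inl b)
  have d2 : Dj G' H' := fun u v a b => d0' u v a (Or.inr b)
  refine ⟨(H ⊔ H') ⊔ (A ⊔ A'), _, w0.union (w.union w'), ?_, ?_⟩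
  · have e : (H ⊔ H') ⊔ (A ⊔ A') ⊔ G = (A ⊔ (G ⊔ H')) ⊔ (A' ⊔ H) := by ac_rfl
    rw [e]
    refine h3.sup h3' (Dj.sup_left ?_ (Dj.sup_left ?_ ?_))
    · exact Dj.sup_right (w'.dj w.sIn).symm (w.dj sH)
    · exact Dj.sup_right (w'.dj (hG.mono (hs.trans hs'))).symm d1
    · exact Dj.sup_right (w'.dj (sH'.mono hs')).symm d3.symm
  · have e : (H ⊔ H') ⊔ (A ⊔ A') ⊔ G' = (A ⊔ (G' ⊔ H)) ⊔ (A' ⊔ H') := by ac_rfl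
    rw [e]
    refine h4.sup h4' (Dj.sup_left ?_ (Dj.sup_left ?_ ?_))
    · exact Dj.sup_right (w'.dj w.sIn).symm (w.dj sH')
    · exact Dj.sup_right (w'.dj (hG'.mono (hs.trans hs'))).symm d2
    · exact Dj.sup_right (w'.dj (sH.mono hs')).symm d3

/-- union of a family -/
def gsum {V ι : Type} (I : Finset ι) (G : ι → SimpleGraph V) : SimpleGraph V where
  Adj u v := ∃ i ∈ I, (G i).Adj u v
  symm := ⟨fun _ _ ⟨i, hi, h⟩ => ⟨i, hi, h.symm⟩⟩
  loopless := ⟨fun _ ⟨_, _, h⟩ => h.ne rfl⟩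

theorem gsum_adj {V ι : Type} {I : Finset ι} {G : ι → SimpleGraph V} {u v : V} :
    (gsum I G).Adj u v ↔ ∃ i ∈ I, (G i).Adj u v := Iff.rfl

theorem gsum_empty {V ι : Type} {G : ι → SimpleGraph V} : gsum ∅ G = ⊥ := by
  ext u v; simp [gsum_adj]

theorem gsum_union {V ι : Type} [DecidableEq ι] {I J : Finset ι} {G : ι → SimpleGraph V} :
    gsum (I ∪ J) G = gsum I G ⊔ gsum J G := by
  ext u v; simp [gsum_adj]; grind

theorem gsum_insert {V ι : Type} [DecidableEq ι] {i : ι} {J : Finset ι} {G : ι → SimpleGraph V} :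
    gsum (insert i J) G = gsum J G ⊔ G i := by
  ext u v; simp [gsum_adj]; grind

theorem SIn.gsum {V ι : Type} {Z : Finset V} {I : Finset ι} {G : ι → SimpleGraph V}
    (h : ∀ i ∈ I, SIn Z (G i)) : SIn Z (gsum I G) := by
  rintro u v ⟨i, hi, huv⟩
  exact h i hi u v huv

theorem KDec.gsum {V ι : Type} {q : ℕ} {I : Finset ι} {G : ι → SimpleGraph V}
    (h : ∀ i ∈ I, KDec q (G i)) (hd : ∀ i ∈ I, ∀ j ∈ I, i ≠ j → Dj (G i) (G j)) :
    KDec q (gsum I G) := by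
  classical
  induction I using Finset.induction_on with
  | empty => rw [gsum_empty]; exact KDec.bot
  | insert i J hi ih =>
    rw [gsum_insert]
    refine (ih (fun j hj => h j (by simp [hj])) (fun j hj k hk => hd j (by simp [hj]) k (by simp [hk]))).sup
      (h i (by simp)) ?_
    rintro u v ⟨j, hj, h1⟩ h2
    exact hd j (by simp [hj]) i (by simp) (by rintro rfl; exact hi hj) u v h1 h2

theorem Tr.sum {V ι : Type} {q d : ℕ} {Y : Finset V} {I : Finset ι} {G H : ι → SimpleGraph V}
    (h : ∀ i ∈ I, ∀ Z, Y ⊆ Z → Tr q d Z (G i) (H i))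
    (hG : ∀ i ∈ I, SIn Y (G i)) (hH : ∀ i ∈ I, SIn Y (H i))
    (dG : ∀ i ∈ I, ∀ j ∈ I, i ≠ j → Dj (G i) (G j))
    (dH : ∀ i ∈ I, ∀ j ∈ I, i ≠ j → Dj (H i) (H j)) :
    ∀ Z, Y ⊆ Z → Tr q d Z (gsum I G) (gsum I H) := by
  classical
  induction I using Finset.induction_on with
  | empty => intro Z _; rw [gsum_empty, gsum_empty]; exact Tr.bot
  | insert i J hi ih =>
    intro Z hZ
    rw [gsum_insert, gsum_insert]
    have m : ∀ j ∈ J, j ∈ insert i J := fun j hj => by simp [hj]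
    have ih' := ih (fun j hj => h j (m j hj)) (fun j hj => hG j (m j hj))
      (fun j hj => hH j (m j hj)) (fun j hj k hk => dG j (m j hj) k (m k hk))
      (fun j hj k hk => dH j (m j hj) k (m k hk)) Z hZ
    refine ih'.add (fun Z' hZ' => h i (by simp) Z' (hZ.trans hZ'))
      (SIn.gsum fun j hj => (hG j (m j hj)).mono hZ) (SIn.gsum fun j hj => (hH j (m j hj)).mono hZ)
      ((hG i (by simp)).mono hZ) ((hH i (by simp)).mono hZ) ?_ ?_
    · rintro u v ⟨j, hj, h1⟩ h2
      exact dG j (m j hj) i (by simp) (by rintro rfl; exact hi hj) u v h1 h2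
    · rintro u v ⟨j, hj, h1⟩ h2
      exact dH j (m j hj) i (by simp) (by rintro rfl; exact hi hj) u v h1 h2

structure Gad (q : ℕ) (T : Type) (F : SimpleGraph T) (P : Finset T)
    (𝒟 : Set (Finset T)) : Prop where
  dec2 : IsKqDecomp q F 𝒟
  decP : ∃ 𝒟1, IsKqDecomp q F 𝒟1 ∧ P ∈ 𝒟1
  meet : ∀ S ∈ 𝒟, ∀ a ∈ P, ∀ b ∈ P, ∀ c ∈ P, a ∈ S → b ∈ S → c ∈ S → a ≠ b → a ≠ c → b ≠ c → False

def gF (q p : ℕ) : SimpleGraph (Fin q × ZMod p) where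
  Adj s t := s.1 ≠ t.1
  symm := ⟨fun _ _ h => h.symm⟩
  loopless := ⟨fun _ h => h rfl⟩

def blk (q p : ℕ) (c : Fin q → ZMod p) (a b : ZMod p) : Finset (Fin q × ZMod p) :=
  Finset.univ.map ⟨fun i : Fin q => (i, a + b * (i.val : ZMod p) + c i), fun i j h => by
    simpa using congrArg Prod.fst h⟩

theorem mem_blk {q p : ℕ} {c : Fin q → ZMod p} {a b : ZMod p} {t : Fin q × ZMod p} :
    t ∈ blk q p c a b ↔ t.2 = a + b * (t.1.val : ZMod p) + c t.1 := by
  rcases t with ⟨i, u⟩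
  simp only [blk, Finset.mem_map, Finset.mem_univ, true_and]
  constructor
  · rintro ⟨j, hj⟩
    have h1 : j = i := congrArg Prod.fst hj
    subst h1
    exact (congrArg Prod.snd hj).symm
  · intro h
    exact ⟨i, Prod.ext rfl h.symm⟩

theorem cast_inj' {q p : ℕ} (hqp : q ≤ p) {i j : Fin q} (h : (i.val : ZMod p) = j.val) : i = j := by
  rw [ZMod.natCast_eq_natCast_iff', Nat.mod_eq_of_lt (by omega), Nat.mod_eq_of_lt (by omega)] at h
  exact Fin.ext h

theorem blk_decomp {q p : ℕ} [Fact p.Prime] (hqp : q ≤ p) (c : Fin q → ZMod p) :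
    IsKqDecomp q (gF q p) {S | ∃ a b, S = blk q p c a b} := by
  rw [decomp_iff]
  constructor
  · rintro _ ⟨a, b, rfl⟩
    refine ⟨?_, by simp [blk]⟩
    intro s hs t ht hst h1
    rw [Finset.mem_coe, mem_blk] at hs ht
    exact hst (Prod.ext h1 (by rw [hs, ht, h1]))
  · rintro ⟨i, u⟩ ⟨j, w⟩ hij
    have hij : i ≠ j := hij
    have hne : (i.val : ZMod p) - j.val ≠ 0 := fun h => hij (cast_inj' hqp (sub_eq_zero.1 h))
    set x : ZMod p := (i.val : ZMod p) with hx
    set y : ZMod p := (j.val : ZMod p) with hy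
    set b := ((u - c i) - (w - c j)) / (x - y) with hb
    have hb' : b * (x - y) = (u - c i) - (w - c j) := by rw [hb]; field_simp
    refine ⟨blk q p c (u - c i - b * x) b, ⟨⟨_, _, rfl⟩, ?_, ?_⟩, ?_⟩
    · rw [mem_blk]; simp only; ring
    · rw [mem_blk]; simp only [← hy]; linear_combination hb'
    · rintro _ ⟨⟨a', b', rfl⟩, h1, h2⟩
      rw [mem_blk] at h1 h2
      simp only [← hx, ← hy] at h1 h2
      have : b' = b := by
        apply mul_right_cancel₀ hne
        linear_combination -hb' - h1 + h2
      subst this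
      congr 1
      linear_combination -h1

theorem exists_gad (q : ℕ) : ∃ (T : Type) (_ : Fintype T) (F : SimpleGraph T) (P : Finset T)
    (𝒟 : Set (Finset T)), Gad q T F P 𝒟 := by
  obtain ⟨p, hqp, hp⟩ := Nat.exists_infinite_primes q
  haveI : Fact p.Prime := ⟨hp⟩
  haveI : NeZero p := ⟨hp.ne_zero⟩
  refine ⟨Fin q × ZMod p, inferInstance, gF q p, blk q p (fun _ => 0) 0 0, _,
    blk_decomp hqp (fun i => (i.val : ZMod p) ^ 2), ⟨_, blk_decomp hqp _, ⟨0, 0, rfl⟩⟩, ?_⟩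
  rintro _ ⟨a, b, rfl⟩ ⟨i, u⟩ hi ⟨j, v⟩ hj ⟨k, w⟩ hk hi' hj' hk' hij hik hjk
  rw [mem_blk] at hi hj hk hi' hj' hk'
  simp only [zero_mul, add_zero] at hi hj hk hi' hj' hk'
  subst hi hj hk
  have hij : i ≠ j := by rintro rfl; exact hij rfl
  have hik : i ≠ k := by rintro rfl; exact hik rfl
  have hjk : j ≠ k := by rintro rfl; exact hjk rfl
  have n1 : (i.val : ZMod p) - j.val ≠ 0 := fun h => hij (cast_inj' hqp (sub_eq_zero.1 h))
  have n2 : (i.val : ZMod p) - k.val ≠ 0 := fun h => hik (cast_inj' hqp (sub_eq_zero.1 h))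
  have e1 : b + i.val + j.val = 0 := by
    apply mul_left_cancel₀ n1
    linear_combination hj' - hi'
  have e2 : b + i.val + k.val = 0 := by
    apply mul_left_cancel₀ n2
    linear_combination hk' - hi'
  exact hjk (cast_inj' hqp (by linear_combination e1 - e2))

open Classical in
theorem exists_place {T V : Type} [Finite T] [Infinite V] (P : Finset T) (g : T → V)
    (hg : Set.InjOn g P) (Z : Finset V) (hZ : ∀ t ∈ P, g t ∈ Z) :
    ∃ f : T ↪ V, (∀ t ∈ P, f t = g t) ∧ ∀ t, t ∉ P → f t ∉ Z := by
  haveI : Infinite {v : V // v ∉ Z} := by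
    have := Z.finite_toSet.infinite_compl
    exact this.to_subtype
  haveI := Fintype.ofFinite T
  obtain ⟨h⟩ : Nonempty (T ↪ {v : V // v ∉ Z}) :=
    ⟨(Fintype.equivFin T).toEmbedding.trans (Fin.valEmbedding.trans (Infinite.natEmbedding _))⟩
  refine ⟨⟨fun t => if t ∈ P then g t else h t, ?_⟩, ?_, ?_⟩
  · intro s t hst
    by_cases hs : s ∈ P <;> by_cases ht : t ∈ P <;> simp only [hs, ht, if_true, if_false] at hst
    · exact hg hs ht hst
    · exact ((h t).2 (hst ▸ hZ s hs)).elim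
    · exact ((h s).2 (hst ▸ hZ t ht)).elim
    · exact h.injective (Subtype.ext hst)
  · intro t ht
    exact if_pos ht
  · intro t ht
    have : (if t ∈ P then g t else (h t : V)) = h t := if_neg ht
    exact fun h' => (h t).2 (this ▸ h')

open Classical in
theorem exists_bij {T V : Type} (P : Finset T) (C : Finset V) (h : P.card = C.card)
    (hne : Nonempty V) :
    ∃ g : T → V, Set.InjOn g P ∧ P.image g = C := by
  obtain ⟨e⟩ : Nonempty (P ≃ C) := ⟨Finset.equivOfCardEq h⟩
  refine ⟨fun t => if ht : t ∈ P then e ⟨t, ht⟩ else hne.some, ?_, ?_⟩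
  · intro s hs t ht hst
    simp only [Finset.mem_coe] at hs ht
    simp only [hs, ht, dif_pos] at hst
    simpa using e.injective (Subtype.ext hst)
  · ext v
    simp only [Finset.mem_image]
    constructor
    · rintro ⟨t, ht, rfl⟩
      simp [ht]
    · intro hv
      exact ⟨e.symm ⟨v, hv⟩, (e.symm ⟨v, hv⟩).2, by simp⟩

open Classical in
theorem exists_bij2 {T V : Type} (P : Finset T) (C : Finset V) (h : P.card = C.card)
    {a b : T} {x y : V} (ha : a ∈ P) (hb : b ∈ P) (hab : a ≠ b) (hx : x ∈ C) (hy : y ∈ C)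
    (hxy : x ≠ y) :
    ∃ g : T → V, Set.InjOn g P ∧ P.image g = C ∧ g a = x ∧ g b = y := by
  obtain ⟨g, hg, hgC⟩ := exists_bij P C h ⟨x⟩
  set s := Equiv.swap (g a) x
  set t := Equiv.swap (s (g b)) y
  have hgab : g a ≠ g b := fun h => hab (hg ha hb h)
  have hsa : s (g a) = x := Equiv.swap_apply_left _ _
  have hsb : s (g b) ≠ x := fun h => hgab (s.injective (hsa.trans h.symm))
  have hta : t x = x := Equiv.swap_apply_of_ne_of_ne hsb.symm hxy
  have htb : t (s (g b)) = y := Equiv.swap_apply_left _ _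
  have hgaC : g a ∈ C := hgC ▸ Finset.mem_image_of_mem g ha
  have hgbC : g b ∈ C := hgC ▸ Finset.mem_image_of_mem g hb
  have swC : ∀ u v : V, u ∈ C → v ∈ C → ∀ w ∈ C, Equiv.swap u v w ∈ C := by
    intro u v hu hv w hw
    rw [Equiv.swap_apply_def]
    split_ifs <;> assumption
  have hs : ∀ w ∈ C, s w ∈ C := swC _ _ hgaC hx
  have ht : ∀ w ∈ C, t w ∈ C := swC _ _ (hs _ hgbC) hy
  have hinj : Set.InjOn (fun z => t (s (g z))) P := by
    intro u hu v hv huv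
    exact hg hu hv (s.injective (t.injective huv))
  refine ⟨fun z => t (s (g z)), hinj, ?_, ?_, ?_⟩
  · apply Finset.eq_of_subset_of_card_le
    · intro v hv
      obtain ⟨z, hz, rfl⟩ := Finset.mem_image.1 hv
      exact ht _ (hs _ (hgC ▸ Finset.mem_image_of_mem g hz))
    · rw [Finset.card_image_of_injOn hinj, h]
  · simp only [hsa, hta]
  · simp only [htb]

theorem Gad.adj {q : ℕ} {T : Type} {F : SimpleGraph T} {P : Finset T} {𝒟 : Set (Finset T)}
    (h : Gad q T F P 𝒟) {a b : T} (ha : a ∈ P) (hb : b ∈ P) (hab : a ≠ b) : F.Adj a b := by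
  obtain ⟨D, hD, hP⟩ := h.decP
  exact nclique_adj (hD.1 P hP) ha hb hab

theorem Gad.card {q : ℕ} {T : Type} {F : SimpleGraph T} {P : Finset T} {𝒟 : Set (Finset T)}
    (h : Gad q T F P 𝒟) : P.card = q := by
  obtain ⟨D, hD, hP⟩ := h.decP
  exact (hD.1 P hP).2

theorem Gad.remP {q : ℕ} {T V : Type} {F : SimpleGraph T} {P : Finset T} {𝒟 : Set (Finset T)}
    (h : Gad q T F P 𝒟) (f : T ↪ V) {G : SimpleGraph V}
    (hG : ∀ u v, G.Adj u v ↔ (F.map f).Adj u v ∧ ¬ (u ∈ P.map f ∧ v ∈ P.map f)) : KDec q G := by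
  obtain ⟨D, hD, hP⟩ := h.decP
  refine KDec.remove (decomp_map f hD) (𝒮 := {P.map f}) ?_ ?_
  · rintro _ rfl; exact ⟨P, hP, rfl⟩
  · intro u v; rw [hG]; simp

theorem Gad.remQ {q : ℕ} {T V : Type} {F : SimpleGraph T} {P Q : Finset T} {𝒟 : Set (Finset T)}
    (h : Gad q T F P 𝒟) (hQ : Q ∈ 𝒟) (f : T ↪ V) {G : SimpleGraph V}
    (hG : ∀ u v, G.Adj u v ↔ (F.map f).Adj u v ∧ ¬ (u ∈ Q.map f ∧ v ∈ Q.map f)) : KDec q G := by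
  refine KDec.remove (decomp_map f h.dec2) (𝒮 := {Q.map f}) ?_ ?_
  · rintro _ rfl; exact ⟨Q, hQ, rfl⟩
  · intro u v; rw [hG]; simp

theorem map_mem_range {T V : Type} {F : SimpleGraph T} {f : T ↪ V} {u v : V}
    (h : (F.map f).Adj u v) : ∃ t, f t = u := by
  rw [SimpleGraph.map_adj] at h
  obtain ⟨a, b, hab, rfl, rfl⟩ := h
  exact ⟨a, rfl⟩

open Classical in
theorem bgad {q : ℕ} {T V : Type} [Fintype T] [Infinite V] {F : SimpleGraph T} {P : Finset T}
    {𝒟 : Set (Finset T)} (hG : Gad q T F P 𝒟) {X C C' Z : Finset V} {x y : V} (hxy : x ≠ y)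
    (hC : C.card = q) (hC' : C'.card = q) (hxC : x ∈ C) (hyC : y ∈ C) (hxC' : x ∈ C')
    (hyC' : y ∈ C') (hxX : x ∈ X) (hyX : y ∈ X) (hCX : ∀ v, v ∈ C → v ∈ X → v = x ∨ v = y)
    (hCX' : ∀ v, v ∈ C' → v ∈ X → v = x ∨ v = y) (hCC : ∀ v, v ∈ C → v ∈ C' → v = x ∨ v = y)
    (hZ : X ∪ (C ∪ C') ⊆ Z) :
    Tr q (2 * Fintype.card T) Z (Vg X C) (Vg X C') := by
  have hXZ : ∀ v ∈ X, v ∈ Z := fun v hv => hZ (by simp [hv])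
  have hCZ : ∀ v ∈ C, v ∈ Z := fun v hv => hZ (by simp [hv])
  have hCZ' : ∀ v ∈ C', v ∈ Z := fun v hv => hZ (by simp [hv])
  have h1 : 1 < P.card := by
    rw [hG.card, ← hC]
    exact Finset.one_lt_card.2 ⟨x, hxC, y, hyC, hxy⟩
  obtain ⟨a, ha, b, hb, hab⟩ := Finset.one_lt_card.1 h1
  obtain ⟨Q, ⟨hQ, haQ, hbQ⟩, -⟩ := (decomp_iff.1 hG.dec2).2 a b (hG.adj ha hb hab)
  have hPQ : ∀ t ∈ P, t ∈ Q → t = a ∨ t = b := by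
    intro t ht htQ
    by_contra hcon
    push Not at hcon
    exact hG.meet Q hQ a ha b hb t ht haQ hbQ htQ hab hcon.1.symm hcon.2.symm
  have hQcl : ∀ s ∈ Q, ∀ t ∈ Q, s ≠ t → F.Adj s t := fun s hs t ht hst =>
    nclique_adj (hG.dec2.1 Q hQ) hs ht hst
  obtain ⟨g, hg, hgC, hga, hgb⟩ := exists_bij2 P C (hG.card.trans hC.symm) ha hb hab hxC hyC hxy
  obtain ⟨g', hg', hgC', hga', hgb'⟩ :=
    exists_bij2 P C' (hG.card.trans hC'.symm) ha hb hab hxC' hyC' hxy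
  have gmem : ∀ t ∈ P, g t ∈ C := fun t ht => hgC ▸ Finset.mem_image_of_mem g ht
  have gmem' : ∀ t ∈ P, g' t ∈ C' := fun t ht => hgC' ▸ Finset.mem_image_of_mem g' ht
  obtain ⟨f, hfP, hfN⟩ := exists_place P g hg Z (fun t ht => hCZ _ (gmem t ht))
  have fP : ∀ t ∈ P, f t ∈ C := fun t ht => by rw [hfP t ht]; exact gmem t ht
  have fZ : ∀ t, f t ∈ Z → t ∈ P := fun t ht => by by_contra h; exact hfN t h ht
  have fC : ∀ v ∈ C, ∃ t ∈ P, f t = v := by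
    intro v hv
    rw [← hgC] at hv
    obtain ⟨t, ht, rfl⟩ := Finset.mem_image.1 hv
    exact ⟨t, ht, hfP t ht⟩
  have hfa : f a = x := by rw [hfP a ha, hga]
  have hfb : f b = y := by rw [hfP b hb, hgb]
  obtain ⟨k, hkP, hkN⟩ := exists_place (P ∪ Q) (fun t => if t ∈ P then g' t else f t) (by
    intro s hs t ht hst
    by_cases h1 : s ∈ P <;> by_cases h2 : t ∈ P <;> simp only [h1, h2, if_true, if_false] at hst
    · exact hg' h1 h2 hst
    · exact (hfN t h2 (hst ▸ hCZ' _ (gmem' s h1))).elim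
    · exact (hfN s h1 (hst ▸ hCZ' _ (gmem' t h2))).elim
    · exact f.injective hst) (Z ∪ Finset.univ.map f) (by
    intro t ht
    by_cases h1 : t ∈ P
    · simp only [h1, if_true]
      exact Finset.mem_union_left _ (hCZ' _ (gmem' t h1))
    · simp [h1])
  have kP : ∀ t ∈ P, k t ∈ C' := fun t ht => by
    rw [hkP t (by simp [ht])]; simp only [ht, if_true]; exact gmem' t ht
  have kC : ∀ v ∈ C', ∃ t ∈ P, k t = v := by
    intro v hv
    rw [← hgC'] at hv
    obtain ⟨t, ht, rfl⟩ := Finset.mem_image.1 hv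
    exact ⟨t, ht, by rw [hkP t (by simp [ht])]; simp only [ht, if_true]⟩
  have hka : k a = x := by rw [hkP a (by simp [ha])]; simp only [ha, if_true, hga']
  have hkb : k b = y := by rw [hkP b (by simp [hb])]; simp only [hb, if_true, hgb']
  have kQ : ∀ t ∈ Q, k t = f t := by
    intro t ht
    by_cases h1 : t ∈ P
    · rcases hPQ t h1 ht with rfl | rfl
      · rw [hka, hfa]
      · rw [hkb, hfb]
    · rw [hkP t (by simp [ht])]; simp only [h1, if_false]
  set M := Q.map f with hM
  have hM' : Q.map k = M := by
    ext v; simp only [hM, Finset.mem_map]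
    constructor
    · rintro ⟨t, ht, rfl⟩; exact ⟨t, ht, (kQ t ht).symm⟩
    · rintro ⟨t, ht, rfl⟩; exact ⟨t, ht, kQ t ht⟩
  have hPC : P.map f = C := by
    ext v; simp only [Finset.mem_map]
    constructor
    · rintro ⟨t, ht, rfl⟩; exact fP t ht
    · exact fC v
  have hPC' : P.map k = C' := by
    ext v; simp only [Finset.mem_map]
    constructor
    · rintro ⟨t, ht, rfl⟩; exact kP t ht
    · exact kC v
  have fM : ∀ t ∈ Q, f t ∈ M := fun t ht => Finset.mem_map_of_mem f ht
  have Mf : ∀ v ∈ M, ∃ t ∈ Q, f t = v := fun v hv => by simpa [hM] using hv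
  have xM : x ∈ M := hfa ▸ fM a haQ
  have yM : y ∈ M := hfb ▸ fM b hbQ
  have MZ : ∀ v ∈ M, v ∈ Z → v = x ∨ v = y := by
    intro v hv hvZ
    obtain ⟨t, ht, rfl⟩ := Mf v hv
    rcases hPQ t (fZ t hvZ) ht with rfl | rfl
    · exact Or.inl hfa
    · exact Or.inr hfb
  have clC : ∀ u ∈ C, ∀ v ∈ C, u ≠ v → (F.map f).Adj u v := by
    intro u hu v hv huv
    obtain ⟨s, hs, rfl⟩ := fC u hu
    obtain ⟨t, ht, rfl⟩ := fC v hv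
    exact (SimpleGraph.map_adj _ _ _ _).2 ⟨s, t, hG.adj hs ht (by rintro rfl; exact huv rfl), rfl, rfl⟩
  have clC' : ∀ u ∈ C', ∀ v ∈ C', u ≠ v → (F.map k).Adj u v := by
    intro u hu v hv huv
    obtain ⟨s, hs, rfl⟩ := kC u hu
    obtain ⟨t, ht, rfl⟩ := kC v hv
    exact (SimpleGraph.map_adj _ _ _ _).2 ⟨s, t, hG.adj hs ht (by rintro rfl; exact huv rfl), rfl, rfl⟩
  have clM : ∀ u ∈ M, ∀ v ∈ M, u ≠ v → (F.map f).Adj u v ∧ (F.map k).Adj u v := by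
    intro u hu v hv huv
    obtain ⟨s, hs, rfl⟩ := Mf u hu
    obtain ⟨t, ht, rfl⟩ := Mf v hv
    have := hQcl s hs t ht (by rintro rfl; exact huv rfl)
    exact ⟨(SimpleGraph.map_adj _ _ _ _).2 ⟨s, t, this, rfl, rfl⟩,
      (SimpleGraph.map_adj _ _ _ _).2 ⟨s, t, this, kQ s hs, kQ t ht⟩⟩
  have h12 : ∀ u v w, (F.map f).Adj u v → (F.map k).Adj u w → u ∈ M := by
    intro u v w h1 h2
    obtain ⟨s, rfl⟩ := map_mem_range h1
    obtain ⟨t, ht⟩ := map_mem_range h2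
    by_cases htP : t ∈ P
    · have h3 := kP t htP
      rw [ht] at h3
      rcases hCC _ (fP s (fZ s (hCZ' _ h3))) h3 with h | h
      · rw [h]; exact xM
      · rw [h]; exact yM
    · by_cases htQ : t ∈ Q
      · rw [← ht, kQ t htQ]; exact fM t htQ
      · exact (hkN t (by simp [htP, htQ]) (by rw [ht]; simp)).elim
  clear_value M
  let A : SimpleGraph V :=
    { Adj := fun u v => ((F.map f).Adj u v ∧ ¬ (u ∈ C ∧ v ∈ C)) ∨
        ((F.map k).Adj u v ∧ ¬ (u ∈ C' ∧ v ∈ C') ∧ ¬ (u ∈ M ∧ v ∈ M))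
      symm := ⟨by
        rintro u v (⟨h1, h2⟩ | ⟨h1, h2, h3⟩)
        · exact Or.inl ⟨h1.symm, fun h => h2 h.symm⟩
        · exact Or.inr ⟨h1.symm, fun h => h2 h.symm, fun h => h3 h.symm⟩⟩
      loopless := ⟨by
        rintro u (⟨h1, h2⟩ | ⟨h1, h2, h3⟩)
        · exact h1.ne rfl
        · exact h1.ne rfl⟩ }
  let R (G : SimpleGraph V) (S : Finset V) : SimpleGraph V :=
    { Adj := fun u v => G.Adj u v ∧ ¬ (u ∈ S ∧ v ∈ S)
      symm := ⟨fun u v h => ⟨h.1.symm, fun h' => h.2 h'.symm⟩⟩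
      loopless := ⟨fun u h => h.1.ne rfl⟩ }
  have pair : ∀ u v, u ≠ v → (u = x ∨ u = y) → (v = x ∨ v = y) → (u = x ∧ v = y) ∨ (u = y ∧ v = x) := by
    intro u v huv h1 h2
    grind
  refine ⟨A, (Pᶜ).map f ∪ ((P ∪ Q)ᶜ).map k, ?_, ?_, ?_⟩
  · apply Wit.of_degree
    · intro v hv
      rcases Finset.mem_union.1 hv with h | h
      · obtain ⟨t, ht, rfl⟩ := Finset.mem_map.1 h
        exact hfN t (by simpa using ht)
      · obtain ⟨t, ht, rfl⟩ := Finset.mem_map.1 h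
        have := hkN t (by simpa using ht)
        exact fun h' => this (Finset.mem_union_left _ h')
    · have hf1 : ∀ t, f t ∈ (Pᶜ).map f ∪ ((P ∪ Q)ᶜ).map k ∪ Z := by
        intro t
        by_cases ht : t ∈ P
        · exact Finset.mem_union_right _ (hCZ _ (fP t ht))
        · exact Finset.mem_union_left _ (Finset.mem_union_left _ (Finset.mem_map_of_mem f (by simpa using ht)))
      rintro u v (⟨h1, h2⟩ | ⟨h1, h2, h3⟩)
      · obtain ⟨t, rfl⟩ := map_mem_range h1
        exact hf1 t
      · obtain ⟨t, rfl⟩ := map_mem_range h1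
        by_cases ht : t ∈ P
        · exact Finset.mem_union_right _ (hCZ' _ (kP t ht))
        · by_cases htQ : t ∈ Q
          · rw [kQ t htQ]; exact hf1 t
          · exact Finset.mem_union_left _ (Finset.mem_union_right _
              (Finset.mem_map_of_mem k (by simp [ht, htQ])))
    · have m1 : ∀ t, t ∉ P → f t ∈ (Pᶜ).map f ∪ ((P ∪ Q)ᶜ).map k := fun t ht =>
        Finset.mem_union_left _ (Finset.mem_map_of_mem f (by simpa using ht))
      have m2 : ∀ t, t ∉ P → k t ∈ (Pᶜ).map f ∪ ((P ∪ Q)ᶜ).map k := fun t ht => by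
        by_cases htQ : t ∈ Q
        · rw [kQ t htQ]; exact m1 t ht
        · exact Finset.mem_union_right _ (Finset.mem_map_of_mem k (by simp [ht, htQ]))
      rintro u v (⟨h1, h2⟩ | ⟨h1, h2, h3⟩)
      · obtain ⟨s, rfl⟩ := map_mem_range h1
        obtain ⟨t, rfl⟩ := map_mem_range h1.symm
        by_cases hs : s ∈ P
        · by_cases ht : t ∈ P
          · exact (h2 ⟨fP s hs, fP t ht⟩).elim
          · exact Or.inr (m1 t ht)
        · exact Or.inl (m1 s hs)
      · obtain ⟨s, rfl⟩ := map_mem_range h1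
        obtain ⟨t, rfl⟩ := map_mem_range h1.symm
        by_cases hs : s ∈ P
        · by_cases ht : t ∈ P
          · exact (h2 ⟨kP s hs, kP t ht⟩).elim
          · exact Or.inr (m2 t ht)
        · exact Or.inl (m2 s hs)
    · intro u hu
      refine ⟨Finset.univ.map f ∪ Finset.univ.map k, ?_, ?_⟩
      · refine (Finset.card_union_le _ _).trans ?_
        simp [Finset.card_map, two_mul]
      · rintro v (⟨h1, h2⟩ | ⟨h1, h2, h3⟩)
        · obtain ⟨t, rfl⟩ := map_mem_range h1.symm
          simp
        · obtain ⟨t, rfl⟩ := map_mem_range h1.symm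
          simp
  · have e : A ⊔ Vg X C = R (F.map f) M ⊔ R (F.map k) C' := by
      ext u v
      show (((F.map f).Adj u v ∧ ¬ (u ∈ C ∧ v ∈ C)) ∨
        ((F.map k).Adj u v ∧ ¬ (u ∈ C' ∧ v ∈ C') ∧ ¬ (u ∈ M ∧ v ∈ M))) ∨
          (u ≠ v ∧ u ∈ C ∧ v ∈ C ∧ ¬ (u ∈ X ∧ v ∈ X)) ↔
          ((F.map f).Adj u v ∧ ¬ (u ∈ M ∧ v ∈ M)) ∨ ((F.map k).Adj u v ∧ ¬ (u ∈ C' ∧ v ∈ C'))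
      by_cases huv : u = v
      · subst huv; simp
      have q1 := clC u
      have q2 := clM u
      have q3 := h12 u v v
      have q3' : (F.map f).Adj u v → (F.map k).Adj u v → v ∈ M := fun a b => h12 v u u a.symm b.symm
      have q4 := hCX u
      have q5 := hCX v
      have q6 := MZ u
      have q7 := MZ v
      have q8 := hCZ u
      have q9 := hCZ v
      have q10 := hCZ' u
      have q11 := hCZ' v
      clear_value A R
      grind
    rw [e]
    refine KDec.sup ?_ ?_ ?_
    · exact hG.remQ hQ f (fun u v => by rw [← hM])
    · exact hG.remP k (fun u v => by rw [hPC'])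
    · rintro u v ⟨h1, h2⟩ ⟨h3, h4⟩
      exact h2 ⟨h12 u v v h1 h3, h12 v u u h1.symm h3.symm⟩
  · have e : A ⊔ Vg X C' = R (F.map f) C ⊔ R (F.map k) M := by
      ext u v
      show (((F.map f).Adj u v ∧ ¬ (u ∈ C ∧ v ∈ C)) ∨
        ((F.map k).Adj u v ∧ ¬ (u ∈ C' ∧ v ∈ C') ∧ ¬ (u ∈ M ∧ v ∈ M))) ∨
          (u ≠ v ∧ u ∈ C' ∧ v ∈ C' ∧ ¬ (u ∈ X ∧ v ∈ X)) ↔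
          ((F.map f).Adj u v ∧ ¬ (u ∈ C ∧ v ∈ C)) ∨ ((F.map k).Adj u v ∧ ¬ (u ∈ M ∧ v ∈ M))
      by_cases huv : u = v
      · subst huv; simp
      have q1 := clC' u
      have q2 := clM u
      have q3 := h12 u v v
      have q3' : (F.map f).Adj u v → (F.map k).Adj u v → v ∈ M := fun a b => h12 v u u a.symm b.symm
      have q4 := hCX' u
      have q5 := hCX' v
      have q6 := MZ u
      have q7 := MZ v
      have q10 := hCZ' u
      have q11 := hCZ' v
      clear_value A R
      grind
    rw [e]
    refine KDec.sup ?_ ?_ ?_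
    · exact hG.remP f (fun u v => by rw [hPC])
    · exact hG.remQ hQ k (fun u v => by rw [hM'])
    · rintro u v ⟨h1, h2⟩ ⟨h3, h4⟩
      exact h4 ⟨h12 u v v h1 h3, h12 v u u h1.symm h3.symm⟩

structure Lab (q : ℕ) {V E : Type} (X : Finset V) (ends : E → Finset V)
    (C : E × ℕ → Finset V) : Prop where
  card : ∀ u, (C u).card = q
  ecard : ∀ e, (ends e).card = 2
  esub : ∀ e, ends e ⊆ X
  cap : ∀ u v, v ∈ C u → v ∈ X → v ∈ ends u.1
  sub : ∀ u, ends u.1 ⊆ C u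
  inj : Function.Injective ends
  surj : ∀ x ∈ X, ∀ y ∈ X, x ≠ y → ∃ e, x ∈ ends e ∧ y ∈ ends e
  disj : ∀ u u' v, v ∈ C u → v ∈ C u' → v ∉ X → u = u'
  fresh : ∀ Z : Finset V, ∃ n, ∀ e k, n ≤ k → ∀ v ∈ C (e, k), v ∈ Z → v ∈ X

section
variable {q d : ℕ} {V E : Type} {X : Finset V} {ends : E → Finset V} {C : E × ℕ → Finset V}

abbrev gr (X : Finset V) (C : E × ℕ → Finset V) (U : Finset (E × ℕ)) : SimpleGraph V :=
  gsum U fun u => Vg X (C u)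

open Classical in
theorem Lab.wit (h : Lab q X ends C) (hd : q ≤ d) {Z : Finset V} (hX : X ⊆ Z)
    {U : Finset (E × ℕ)} (hU : ∀ u ∈ U, ∀ v ∈ C u, v ∈ Z → v ∈ X) :
    Wit d Z (gr X C U) (U.biUnion C \ X) := by
  apply Wit.of_degree
  · intro v hv hvZ
    simp only [Finset.mem_sdiff, Finset.mem_biUnion] at hv
    obtain ⟨⟨u, hu, hvu⟩, hvX⟩ := hv
    exact hvX (hU u hu v hvu hvZ)
  · rintro v w ⟨u, hu, hvw⟩
    by_cases hvX : v ∈ X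
    · exact Finset.mem_union_right _ (hX hvX)
    · simp only [Finset.mem_union, Finset.mem_sdiff, Finset.mem_biUnion]
      exact Or.inl ⟨⟨u, hu, hvw.2.1⟩, hvX⟩
  · rintro v w ⟨u, hu, hvw⟩
    simp only [Finset.mem_sdiff, Finset.mem_biUnion]
    by_cases hvX : v ∈ X
    · exact Or.inr ⟨⟨u, hu, hvw.2.2.1⟩, fun hw => hvw.2.2.2 ⟨hvX, hw⟩⟩
    · exact Or.inl ⟨⟨u, hu, hvw.2.1⟩, hvX⟩
  · intro v hv
    simp only [Finset.mem_sdiff, Finset.mem_biUnion] at hv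
    obtain ⟨⟨u, hu, hvu⟩, hvX⟩ := hv
    refine ⟨C u, (h.card u).trans_le hd, ?_⟩
    rintro w ⟨u', hu', hvw⟩
    rw [h.disj u u' v hvu hvw.2.1 hvX]
    exact hvw.2.2.1

theorem Lab.vdj (h : Lab q X ends C) {u u' : E × ℕ} (huu : u ≠ u') :
    Dj (Vg X (C u)) (Vg X (C u')) := by
  rintro v w ⟨h1, h2, h3, h4⟩ ⟨h1', h2', h3', h4'⟩
  by_cases hv : v ∈ X
  · exact huu (h.disj u u' w h3 h3' (fun hw => h4 ⟨hv, hw⟩))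
  · exact huu (h.disj u u' v h2 h2' hv)

theorem Lab.dj (h : Lab q X ends C) {U U' : Finset (E × ℕ)} (hUU : ∀ u ∈ U, u ∉ U') :
    Dj (gr X C U) (gr X C U') := by
  rintro v w ⟨u, hu, h1⟩ ⟨u', hu', h2⟩
  exact h.vdj (by rintro rfl; exact hUU u hu hu') v w h1 h2

open Classical in
theorem gr_sIn {Z : Finset V} {U : Finset (E × ℕ)} (hZ : U.biUnion C ⊆ Z) :
    SIn Z (gr X C U) := by
  rintro v w ⟨u, hu, h1⟩
  exact hZ (Finset.mem_biUnion.2 ⟨u, hu, h1.2.1⟩)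

open Classical in
def LRel (q d : ℕ) (X : Finset V) (C : E × ℕ → Finset V) (U U' : Finset (E × ℕ)) : Prop :=
  ∀ Z, X ∪ (U.biUnion C ∪ U'.biUnion C) ⊆ Z → Tr q d Z (gr X C U) (gr X C U')

open Classical in
noncomputable def cnt (U : Finset (E × ℕ)) (e : E) : ℤ := ((U.filter fun u => u.1 = e).card : ℤ)

open Classical in
theorem cnt_union {U U' : Finset (E × ℕ)} (h : ∀ u ∈ U, u ∉ U') (e : E) :
    cnt (U ∪ U') e = cnt U e + cnt U' e := by
  unfold cnt
  rw [Finset.filter_union, Finset.card_union_of_disjoint]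
  · push_cast; rfl
  · rw [Finset.disjoint_left]
    intro u hu hu'
    exact h u (Finset.mem_filter.1 hu).1 (Finset.mem_filter.1 hu').1

open Classical in
theorem Lab.zero [Infinite V] (h : Lab q X ends C) {T : Type} [Fintype T] {F : SimpleGraph T}
    {P : Finset T} {𝒟 : Set (Finset T)} (hG : Gad q T F P 𝒟) (U : Finset (E × ℕ)) :
    ∀ U' : Finset (E × ℕ), (∀ u ∈ U, u ∉ U') → (∀ e, cnt U e = cnt U' e) →
      LRel q (2 * Fintype.card T) X C U U' := by
  induction U using Finset.induction_on with
  | empty =>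
    intro U' _ hc Z _
    have : U' = ∅ := by
      rw [Finset.eq_empty_iff_forall_notMem]
      intro u hu
      have := hc u.1
      simp only [cnt, Finset.filter_empty, Finset.card_empty] at this
      have h0 : (U'.filter fun v => v.1 = u.1).card = 0 := by exact_mod_cast this.symm
      rw [Finset.card_eq_zero] at h0
      exact Finset.notMem_empty u (h0 ▸ Finset.mem_filter.2 ⟨hu, rfl⟩)
    subst this
    show Tr _ _ Z (gsum ∅ _) (gsum ∅ _)
    rw [gsum_empty]
    exact Tr.bot
  | insert u U hu ih =>
    intro U' hd hc Z hZ
    have hpos : 0 < cnt U' u.1 := by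
      rw [← hc, cnt]
      exact_mod_cast Finset.card_pos.2 ⟨u, by simp⟩
    obtain ⟨u', hu'⟩ : (U'.filter fun v => v.1 = u.1).Nonempty := by
      rw [← Finset.card_pos]; unfold cnt at hpos; exact_mod_cast hpos
    obtain ⟨hu'1, hu'2⟩ := Finset.mem_filter.1 hu'
    have hins : insert u' (U'.erase u') = U' := Finset.insert_erase hu'1
    have c1 : ∀ e, cnt (insert u U) e = cnt U e + cnt {u} e := by
      intro e
      rw [Finset.insert_eq, Finset.union_comm, cnt_union]
      intro v hv hv'
      rw [Finset.mem_singleton] at hv'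
      exact hu (hv' ▸ hv)
    have c2 : ∀ e, cnt U' e = cnt (U'.erase u') e + cnt {u'} e := by
      intro e
      conv_lhs => rw [← hins]
      rw [Finset.insert_eq, Finset.union_comm, cnt_union]
      intro v hv hv'
      rw [Finset.mem_singleton] at hv'
      simp [hv'] at hv
    have c3 : ∀ e, cnt {u} e = cnt {u'} e := by
      intro e
      simp only [cnt, Finset.filter_singleton, hu'2]
      split_ifs <;> simp
    have hne : u ≠ u' := fun hh => hd u (by simp) (hh ▸ hu'1)
    have s1 : X ⊆ Z := fun v hv => hZ (by simp [hv])
    have s2 : (insert u U).biUnion C ⊆ Z := fun v hv => hZ (by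
      exact Finset.mem_union_right _ (Finset.mem_union_left _ hv))
    have s3 : U'.biUnion C ⊆ Z := fun v hv => hZ (by
      exact Finset.mem_union_right _ (Finset.mem_union_right _ hv))
    have s4 : U.biUnion C ⊆ Z :=
      (Finset.biUnion_subset_biUnion_of_subset_left C (Finset.subset_insert _ _)).trans s2
    have s5 : (U'.erase u').biUnion C ⊆ Z :=
      (Finset.biUnion_subset_biUnion_of_subset_left C (Finset.erase_subset _ _)).trans s3
    have s6 : C u ⊆ Z := fun v hv => s2 (Finset.mem_biUnion.2 ⟨u, by simp, hv⟩)
    have s7 : C u' ⊆ Z := fun v hv => s3 (Finset.mem_biUnion.2 ⟨u', hu'1, hv⟩)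
    rw [← hins]
    show Tr _ _ Z (gsum _ _) (gsum _ _)
    rw [gsum_insert, gsum_insert]
    refine (ih (U'.erase u') ?_ ?_ Z ?_).add ?_ (gr_sIn s4) (gr_sIn s5) ?_ ?_ ?_ ?_
    · intro v hv hv'
      exact hd v (by simp [hv]) (Finset.mem_of_mem_erase hv')
    · intro e
      have := hc e
      rw [c1, c2, c3] at this
      linarith
    · exact Finset.union_subset s1 (Finset.union_subset s4 s5)
    · intro Z' hZ'
      obtain ⟨x, y, hxy, he⟩ := Finset.card_eq_two.1 (h.ecard u.1)
      have ex : x ∈ ends u.1 := by simp [he]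
      have ey : y ∈ ends u.1 := by simp [he]
      refine bgad hG hxy (h.card u) (h.card u') (h.sub u ex) (h.sub u ey)
        (h.sub u' (hu'2 ▸ ex)) (h.sub u' (hu'2 ▸ ey)) (h.esub _ ex) (h.esub _ ey) ?_ ?_ ?_ ?_
      · intro v hv hvX
        simpa [he] using h.cap u v hv hvX
      · intro v hv hvX
        have := h.cap u' v hv hvX
        rw [hu'2] at this
        simpa [he] using this
      · intro v hv hv'
        by_cases hvX : v ∈ X
        · simpa [he] using h.cap u v hv hvX
        · exact (hne (h.disj u u' v hv hv' hvX)).elim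
      · exact (Finset.union_subset s1 (Finset.union_subset s6 s7)).trans hZ'
    · intro v w hvw
      exact s6 hvw.2.1
    · intro v w hvw
      exact s7 hvw.2.1
    · rintro v w ⟨j, hj, h1⟩ h2
      exact h.vdj (by rintro rfl; exact hu hj) v w h1 h2
    · rintro v w ⟨j, hj, h1⟩ h2
      exact h.vdj (by rintro rfl; simp at hj) v w h1 h2

/-- The set of good functions. -/
def Good (q d : ℕ) (X : Finset V) (C : E × ℕ → Finset V) (f : E → ℤ) : Prop :=
  ∀ U U' : Finset (E × ℕ), (∀ u ∈ U, u ∉ U') → (∀ e, cnt U e - cnt U' e = f e) →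
    LRel q d X C U U'

theorem Good.neg {f : E → ℤ} (h : Good q d X C f) : Good q d X C (-f) := by
  classical
  intro U U' hd hc Z hZ
  refine (h U' U (fun u hu hu' => hd u hu' hu) ?_ Z ?_).symm
  · intro e
    have := hc e
    simp only [Pi.neg_apply] at this
    linarith
  · refine subset_trans (fun v hv => ?_) hZ
    simp only [Finset.mem_union] at hv ⊢
    tauto

open Classical in
/-- Key gluing. -/
theorem Lab.glue (h : Lab q X ends C) (hq : 3 ≤ q) (hd : q ≤ d)
    {U U' W W' : Finset (E × ℕ)} {Z : Finset V} (hUU : ∀ u ∈ U, u ∉ U') (hWW : ∀ u ∈ W, u ∉ W')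
    (hZ : X ∪ (U.biUnion C ∪ U'.biUnion C) ⊆ Z)
    (hW : ∀ u ∈ W ∪ W', ∀ v ∈ C u, v ∈ Z → v ∈ X)
    (h1 : LRel q d X C (U ∪ W') (U' ∪ W)) (h2 : LRel q d X C W W') :
    Tr q d Z (gr X C U) (gr X C U') := by
  have s1 : X ⊆ Z := fun v hv => hZ (by simp [hv])
  have s2 : U.biUnion C ⊆ Z := fun v hv => hZ (by
    exact Finset.mem_union_right _ (Finset.mem_union_left _ hv))
  have s3 : U'.biUnion C ⊆ Z := fun v hv => hZ (by
    exact Finset.mem_union_right _ (Finset.mem_union_right _ hv))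
  have w0 := h.wit hd s1 hW
  have s4 : (W ∪ W').biUnion C ⊆ Z ∪ ((W ∪ W').biUnion C \ X) := by
    intro v hv
    by_cases hvX : v ∈ X
    · exact Finset.mem_union_left _ (s1 hvX)
    · exact Finset.mem_union_right _ (Finset.mem_sdiff.2 ⟨hv, hvX⟩)
  have s5 : W.biUnion C ⊆ Z ∪ ((W ∪ W').biUnion C \ X) :=
    (Finset.biUnion_subset_biUnion_of_subset_left C Finset.subset_union_left).trans s4
  have s6 : W'.biUnion C ⊆ Z ∪ ((W ∪ W').biUnion C \ X) :=
    (Finset.biUnion_subset_biUnion_of_subset_left C Finset.subset_union_right).trans s4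
  have s0 : Z ⊆ Z ∪ ((W ∪ W').biUnion C \ X) := Finset.subset_union_left
  refine Tr.glue (H := gr X C W) (H' := gr X C W') (N0 := (W ∪ W').biUnion C \ X) ?_ ?_ ?_
    (gr_sIn s2) (gr_sIn s3) (h.dj hWW)
  · have := h1 (Z ∪ ((W ∪ W').biUnion C \ X)) ?_
    · simpa only [gr, gsum_union] using this
    · rw [Finset.union_biUnion, Finset.union_biUnion]
      exact Finset.union_subset (s1.trans s0) (Finset.union_subset
        (Finset.union_subset (s2.trans s0) s6) (Finset.union_subset (s3.trans s0) s5))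
  · intro Z' hZ'
    exact h2 Z' ((Finset.union_subset (s1.trans s0) (Finset.union_subset s5 s6)).trans hZ')
  · simpa only [gr, gsum_union] using w0

open Classical in
/-- labels avoiding `Z` are not in sets whose vertices are in `Z`. -/
theorem Lab.notMem (h : Lab q X ends C) (hq : 3 ≤ q) {U : Finset (E × ℕ)} {Z : Finset V}
    (hZ : U.biUnion C ⊆ Z) {u : E × ℕ} (hu : ∀ v ∈ C u, v ∈ Z → v ∈ X) : u ∉ U := by
  intro huU
  have h1 : C u ⊆ ends u.1 := by
    intro v hv
    exact h.cap u v hv (hu v hv (hZ (Finset.mem_biUnion.2 ⟨u, huU, hv⟩)))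
  have := Finset.card_le_card h1
  rw [h.card, h.ecard] at this
  omega

open Classical in
noncomputable def lab [Fintype E] (n : ℕ) (f : E → ℕ) : Finset (E × ℕ) :=
  Finset.univ.biUnion fun e => (Finset.Ico n (n + f e)).image fun k => (e, k)

theorem mem_lab [Fintype E] {n : ℕ} {f : E → ℕ} {u : E × ℕ} :
    u ∈ lab n f ↔ n ≤ u.2 ∧ u.2 < n + f u.1 := by
  rcases u with ⟨e, k⟩
  simp only [lab, Finset.mem_biUnion, Finset.mem_image, Finset.mem_Ico, Finset.mem_univ, true_and,
    Prod.mk.injEq]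
  constructor
  · rintro ⟨a, b, hb, rfl, rfl⟩; exact hb
  · intro hb; exact ⟨e, k, hb, rfl, rfl⟩

theorem cnt_lab [Fintype E] (n : ℕ) (f : E → ℕ) (e : E) : cnt (lab n f) e = f e := by
  classical
  unfold cnt
  have : (lab n f).filter (fun u => u.1 = e) = (Finset.Ico n (n + f e)).image fun k => (e, k) := by
    ext ⟨a, k⟩
    simp only [Finset.mem_filter, mem_lab, Finset.mem_image, Finset.mem_Ico, Prod.mk.injEq]
    constructor
    · rintro ⟨h1, rfl⟩; exact ⟨k, h1, rfl, rfl⟩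
    · rintro ⟨b, hb, rfl, rfl⟩; exact ⟨hb, rfl⟩
  rw [this, Finset.card_image_of_injective _ (fun a b hab => by simpa using hab)]
  simp

theorem Lab.add [Fintype E] (h : Lab q X ends C) (hq : 3 ≤ q) (hd : q ≤ d) {f g : E → ℤ}
    (hf : Good q d X C f) (hg : Good q d X C g) : Good q d X C (f + g) := by
  classical
  intro U U' hUU hc Z hZ
  obtain ⟨n, hn⟩ := h.fresh Z
  have s2 : U.biUnion C ⊆ Z := fun v hv => hZ (by
    exact Finset.mem_union_right _ (Finset.mem_union_left _ hv))
  have s3 : U'.biUnion C ⊆ Z := fun v hv => hZ (by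
    exact Finset.mem_union_right _ (Finset.mem_union_right _ hv))
  set W := lab n (fun e => (f e).toNat) with hW
  set W' := lab n (fun e => (- f e).toNat) with hW'
  have fr : ∀ u ∈ W ∪ W', ∀ v ∈ C u, v ∈ Z → v ∈ X := by
    intro u hu
    have : n ≤ u.2 := by
      rcases Finset.mem_union.1 hu with hu | hu <;> exact (mem_lab.1 hu).1
    exact hn u.1 u.2 this
  have hWW : ∀ u ∈ W, u ∉ W' := by
    intro u hu hu'
    have h1 := (mem_lab.1 hu)
    have h2 := (mem_lab.1 hu')
    omega
  have m1 : ∀ u ∈ W ∪ W', u ∉ U := fun u hu => h.notMem hq s2 (fr u hu)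
  have m2 : ∀ u ∈ W ∪ W', u ∉ U' := fun u hu => h.notMem hq s3 (fr u hu)
  have cW : ∀ e, cnt W e - cnt W' e = f e := by
    intro e
    rw [hW, hW', cnt_lab, cnt_lab]
    omega
  refine h.glue hq hd hUU hWW hZ fr ?_ (hf W W' hWW cW)
  apply hg
  · intro u hu hu'
    have a1 := m1 u
    have a2 := m2 u
    have a3 := hUU u
    have a4 := hWW u
    simp only [Finset.mem_union] at *
    tauto
  · intro e
    rw [cnt_union, cnt_union]
    · have a1 := cW e
      have a2 := hc e
      simp only [Pi.add_apply] at a2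
      linarith
    · intro u hu hu'
      exact m2 u (by simp [hu']) hu
    · intro u hu hu'
      exact m1 u (by simp [hu']) hu

end

section
variable {q d : ℕ} {V E : Type} {X : Finset V} {ends : E → Finset V} {C : E × ℕ → Finset V}

open Classical in
theorem Lab.base [Infinite V] (h : Lab q X ends C) {T : Type} [Fintype T] {F : SimpleGraph T}
    {P : Finset T} {𝒟 : Set (Finset T)} (hG : Gad q T F P 𝒟) {K : Finset V} (hKX : K ⊆ X)
    (hK : K.card = q) {W : Finset (E × ℕ)} (hW1 : ∀ u ∈ W, ends u.1 ⊆ K)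
    (hW2 : ∀ u ∈ W, ∀ u' ∈ W, u.1 = u'.1 → u = u')
    (hW3 : ∀ e, ends e ⊆ K → ∃ u ∈ W, u.1 = e) :
    LRel q (2 * Fintype.card T) X C W ∅ := by
  intro Z hZ
  have hXZ : X ⊆ Z := fun v hv => hZ (by simp [hv])
  have hCZ : ∀ u ∈ W, C u ⊆ Z := fun u hu v hv => hZ (by
    refine Finset.mem_union_right _ (Finset.mem_union_left _ ?_)
    exact Finset.mem_biUnion.2 ⟨u, hu, hv⟩)
  obtain ⟨v0⟩ : Nonempty V := inferInstance
  obtain ⟨g, hg, hgK⟩ := exists_bij P K (hG.card.trans hK.symm) ⟨v0⟩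
  have gmem : ∀ t ∈ P, g t ∈ K := fun t ht => hgK ▸ Finset.mem_image_of_mem g ht
  obtain ⟨f, hfP, hfN⟩ := exists_place P g hg Z (fun t ht => hXZ (hKX (gmem t ht)))
  have fK : ∀ t ∈ P, f t ∈ K := fun t ht => by rw [hfP t ht]; exact gmem t ht
  have Kf : ∀ v ∈ K, ∃ t ∈ P, f t = v := by
    intro v hv
    rw [← hgK] at hv
    obtain ⟨t, ht, rfl⟩ := Finset.mem_image.1 hv
    exact ⟨t, ht, hfP t ht⟩
  have fZ : ∀ t, f t ∈ Z → t ∈ P := fun t ht => by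
    by_contra hh; exact hfN t hh ht
  have dec := decomp_iff.1 hG.dec2
  have exQ : ∀ u, ∃ S, u ∈ W → S ∈ 𝒟 ∧ ends u.1 ⊆ S.map f := by
    intro u
    by_cases hu : u ∈ W
    · obtain ⟨x, y, hxy, he⟩ := Finset.card_eq_two.1 (h.ecard u.1)
      obtain ⟨a, ha, rfl⟩ := Kf x (hW1 u hu (by simp [he]))
      obtain ⟨b, hb, rfl⟩ := Kf y (hW1 u hu (by simp [he]))
      obtain ⟨S, ⟨hS, haS, hbS⟩, -⟩ := dec.2 a b (hG.adj ha hb (by rintro rfl; exact hxy rfl))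
      refine ⟨S, fun _ => ⟨hS, ?_⟩⟩
      rw [he]
      intro v hv
      simp only [Finset.mem_insert, Finset.mem_singleton] at hv
      rcases hv with rfl | rfl <;> simp [haS, hbS]
    · exact ⟨∅, fun hh => (hu hh).elim⟩
  choose Q hQ using exQ
  have Qcap : ∀ u ∈ W, ∀ v ∈ (Q u).map f, v ∈ Z → v ∈ ends u.1 := by
    intro u hu v hv hvZ
    obtain ⟨x, y, hxy, he⟩ := Finset.card_eq_two.1 (h.ecard u.1)
    obtain ⟨hQD, hsub⟩ := hQ u hu
    obtain ⟨t, htQ, rfl⟩ := Finset.mem_map.1 hv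
    obtain ⟨a, haQ, rfl⟩ := Finset.mem_map.1 (hsub (by simp [he] : x ∈ ends u.1))
    obtain ⟨b, hbQ, rfl⟩ := Finset.mem_map.1 (hsub (by simp [he] : y ∈ ends u.1))
    have haP := fZ a (hXZ (h.esub _ (by simp [he] : f a ∈ ends u.1)))
    have hbP := fZ b (hXZ (h.esub _ (by simp [he] : f b ∈ ends u.1)))
    rw [he]
    by_contra hcon
    simp only [Finset.mem_insert, Finset.mem_singleton, EmbeddingLike.apply_eq_iff_eq,
      not_or] at hcon
    exact hG.meet (Q u) hQD a haP b hbP t (fZ t hvZ) haQ hbQ htQ (by rintro rfl; exact hxy rfl)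
      (Ne.symm hcon.1) (Ne.symm hcon.2)
  have Qinj : ∀ u ∈ W, ∀ u' ∈ W, Q u = Q u' → u = u' := by
    intro u hu u' hu' hQQ
    apply hW2 u hu u' hu'
    apply h.inj
    apply Finset.eq_of_subset_of_card_le
    · intro v hv
      exact Qcap u' hu' v (hQQ ▸ (hQ u hu).2 hv) (hXZ (h.esub _ hv))
    · rw [h.ecard, h.ecard]
  have QF : ∀ u ∈ W, ∀ v ∈ (Q u).map f, ∀ w ∈ (Q u).map f, v ≠ w → (F.map f).Adj v w := by
    intro u hu v hv w hw hvw
    obtain ⟨s, hs, rfl⟩ := Finset.mem_map.1 hv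
    obtain ⟨t, ht, rfl⟩ := Finset.mem_map.1 hw
    rw [SimpleGraph.map_adj]
    exact ⟨s, t, nclique_adj (dec.1 _ (hQ u hu).1) hs ht (by rintro rfl; exact hvw rfl), rfl, rfl⟩
  set N1 : Finset V := (Finset.univ.filter fun t => t ∉ P).map f with hN1
  have fN1 : ∀ t, t ∉ P → f t ∈ N1 := by
    intro t ht
    simp [hN1, ht]
  have fY : ∀ t, f t ∈ Z ∪ N1 := by
    intro t
    by_cases ht : t ∈ P
    · exact Finset.mem_union_left _ (hXZ (hKX (fK t ht)))
    · exact Finset.mem_union_right _ (fN1 t ht)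
  have QY : ∀ S : Finset T, S.map f ⊆ Z ∪ N1 := by
    intro S v hv
    obtain ⟨t, -, rfl⟩ := Finset.mem_map.1 hv
    exact fY t
  have hZY : Z ⊆ Z ∪ N1 := Finset.subset_union_left
  have tr : Tr q (2 * Fintype.card T) (Z ∪ N1) (gsum W fun u => Vg X ((Q u).map f))
      (gsum W fun u => Vg X (C u)) := by
    refine Tr.sum (Y := Z ∪ N1) ?_ ?_ ?_ ?_ ?_ _ subset_rfl
    · intro u hu Z' hZ'
      obtain ⟨x, y, hxy, he⟩ := Finset.card_eq_two.1 (h.ecard u.1)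
      have ex : x ∈ ends u.1 := by simp [he]
      have ey : y ∈ ends u.1 := by simp [he]
      have hc : ((Q u).map f).card = q := by
        rw [Finset.card_map]; exact (dec.1 _ (hQ u hu).1).2
      refine bgad hG hxy hc (h.card u) ((hQ u hu).2 ex) ((hQ u hu).2 ey)
        (h.sub u ex) (h.sub u ey) (h.esub _ ex) (h.esub _ ey) ?_ ?_ ?_ ?_
      · intro v hv hvX
        simpa [he] using Qcap u hu v hv (hXZ hvX)
      · intro v hv hvX
        simpa [he] using h.cap u v hv hvX
      · intro v hv hv'
        simpa [he] using Qcap u hu v hv (hCZ u hu hv')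
      · exact (Finset.union_subset (hXZ.trans hZY) (Finset.union_subset (QY _)
          ((hCZ u hu).trans hZY))).trans hZ'
    · intro u hu v w hvw
      exact QY _ hvw.2.1
    · intro u hu v w hvw
      exact hZY (hCZ u hu hvw.2.1)
    · intro u hu u' hu' huu v w h1 h2
      apply huu
      apply Qinj u hu u' hu'
      obtain ⟨s, hs, rfl⟩ := Finset.mem_map.1 h1.2.1
      obtain ⟨t, ht, rfl⟩ := Finset.mem_map.1 h1.2.2.1
      have hs' : s ∈ Q u' := by simpa using h2.2.1
      have ht' : t ∈ Q u' := by simpa using h2.2.2.1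
      have hadj := nclique_adj (dec.1 _ (hQ u hu).1) hs ht (by rintro rfl; exact h1.1 rfl)
      exact (dec.2 s t hadj).unique ⟨(hQ u hu).1, hs, ht⟩ ⟨(hQ u' hu').1, hs', ht'⟩
    · intro u hu u' hu' huu
      exact h.vdj huu
  obtain ⟨A2, N2, w2, k1, k2⟩ := tr
  set B : SimpleGraph V := F.map f \ Vg ∅ (P.map f) with hB
  have hBadj : ∀ u v, B.Adj u v ↔ (F.map f).Adj u v ∧ ¬ (u ∈ P.map f ∧ v ∈ P.map f) := by
    intro u v
    rw [hB, SimpleGraph.sdiff_adj, Vg_adj]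
    refine and_congr_right fun hadj => not_congr ⟨fun hh => ⟨hh.2.1, hh.2.2.1⟩, fun hh =>
      ⟨hadj.ne, hh.1, hh.2, by simp⟩⟩
  have wB : Wit (2 * Fintype.card T) Z B N1 := by
    apply Wit.of_degree
    · intro v hv
      simp only [hN1, Finset.mem_map, Finset.mem_filter, Finset.mem_univ, true_and] at hv
      obtain ⟨t, ht, rfl⟩ := hv
      exact hfN t ht
    · intro u v huv
      obtain ⟨t, rfl⟩ := map_mem_range ((hBadj u v).1 huv).1
      rw [Finset.union_comm]
      exact fY t
    · intro u v huv
      have h1 := (hBadj u v).1 huv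
      obtain ⟨s, rfl⟩ := map_mem_range h1.1
      obtain ⟨t, rfl⟩ := map_mem_range h1.1.symm
      by_cases hs : s ∈ P
      · by_cases ht : t ∈ P
        · exact (h1.2 ⟨by simpa using hs, by simpa using ht⟩).elim
        · exact Or.inr (fN1 t ht)
      · exact Or.inl (fN1 s hs)
    · intro u _
      refine ⟨Finset.univ.map f, ?_, ?_⟩
      · rw [Finset.card_map, Finset.card_univ]; omega
      · intro v huv
        obtain ⟨t, rfl⟩ := map_mem_range ((hBadj u v).1 huv).1.symm
        simp
  have kB : KDec q B := hG.remP f hBadj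
  have sW : SIn Z (gr X C W) := gr_sIn (by
    intro v hv
    obtain ⟨u, hu, hv⟩ := Finset.mem_biUnion.1 hv
    exact hCZ u hu hv)
  refine ⟨B ⊔ A2, N1 ∪ N2, wB.union w2, ?_, ?_⟩
  · have e : B ⊔ A2 ⊔ gr X C W = (A2 ⊔ gr X C W) ⊔ B := by ac_rfl
    rw [e]
    exact k2.sup kB (Dj.sup_left (w2.dj wB.sIn) (wB.dj sW).symm)
  · set GQ := gsum W fun u => Vg X ((Q u).map f) with hGQ
    set R : SimpleGraph V := F.map f \ gsum W fun u => Vg ∅ ((Q u).map f) with hR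
    have hRadj : ∀ u v, R.Adj u v ↔ (F.map f).Adj u v ∧
        ∀ S ∈ (fun u => (Q u).map f) '' (W : Set (E × ℕ)), ¬ (u ∈ S ∧ v ∈ S) := by
      intro u v
      rw [hR, SimpleGraph.sdiff_adj, gsum_adj]
      refine and_congr_right fun hadj => ?_
      constructor
      · rintro h1 _ ⟨i, hi, rfl⟩ h2
        exact h1 ⟨i, hi, hadj.ne, h2.1, h2.2, by simp⟩
      · rintro h1 ⟨i, hi, h2⟩
        exact h1 _ ⟨i, hi, rfl⟩ ⟨h2.2.1, h2.2.2.1⟩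
    have kR : KDec q R := by
      refine KDec.remove (decomp_map f hG.dec2) ?_ hRadj
      rintro _ ⟨i, hi, rfl⟩
      exact ⟨Q i, (hQ i hi).1, rfl⟩
    have eB : B = GQ ⊔ R := by
      ext v w
      rw [SimpleGraph.sup_adj, hBadj, hRadj, hGQ, gsum_adj]
      constructor
      · rintro ⟨h1, h2⟩
        by_cases h3 : ∃ u ∈ W, v ∈ (Q u).map f ∧ w ∈ (Q u).map f
        · obtain ⟨u, hu, hv, hw⟩ := h3
          refine Or.inl ⟨u, hu, h1.ne, hv, hw, fun hX => h2 ?_⟩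
          obtain ⟨s, rfl⟩ := map_mem_range h1
          obtain ⟨t, rfl⟩ := map_mem_range h1.symm
          exact ⟨by simpa using fZ s (hXZ hX.1), by simpa using fZ t (hXZ hX.2)⟩
        · refine Or.inr ⟨h1, ?_⟩
          rintro _ ⟨u, hu, rfl⟩ hh
          exact h3 ⟨u, hu, hh⟩
      · have pk : ∀ v ∈ P.map f, v ∈ K := by
          intro v hv
          obtain ⟨t, ht, rfl⟩ := Finset.mem_map.1 hv
          exact fK t ht
        rintro (⟨u, hu, h1, h2, h3, h4⟩ | ⟨h1, h2⟩)
        · exact ⟨QF u hu v h2 w h3 h1, fun hh => h4 ⟨hKX (pk v hh.1), hKX (pk w hh.2)⟩⟩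
        · refine ⟨h1, fun hh => ?_⟩
          have hv := pk v hh.1
          have hw := pk w hh.2
          obtain ⟨e, hve, hwe⟩ := h.surj v (hKX hv) w (hKX hw) h1.ne
          have he : ends e = {v, w} := by
            symm
            apply Finset.eq_of_subset_of_card_le
            · intro x hx
              simp only [Finset.mem_insert, Finset.mem_singleton] at hx
              rcases hx with rfl | rfl <;> assumption
            · rw [h.ecard, Finset.card_pair h1.ne]
          obtain ⟨u, hu, rfl⟩ := hW3 e (by
            rw [he]; intro x hx
            simp only [Finset.mem_insert, Finset.mem_singleton] at hx
            rcases hx with rfl | rfl <;> assumption)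
          exact h2 _ ⟨u, hu, rfl⟩ ⟨(hQ u hu).2 hve, (hQ u hu).2 hwe⟩
    have e : B ⊔ A2 ⊔ gr X C ∅ = (A2 ⊔ GQ) ⊔ R := by
      show B ⊔ A2 ⊔ gsum ∅ _ = _
      rw [gsum_empty, sup_bot_eq, eB]; ac_rfl
    rw [e]
    have hRB : ∀ u v, R.Adj u v → B.Adj u v := fun u v huv => by
      rw [eB]; exact Or.inr huv
    refine k1.sup kR (Dj.sup_left ?_ ?_)
    · intro u v a b
      exact w2.dj wB.sIn u v a (hRB u v b)
    · rintro v w ⟨u, hu, hvw⟩ hr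
      exact ((hRadj v w).1 hr).2 _ ⟨u, hu, rfl⟩ ⟨hvw.2.1, hvw.2.2.1⟩

open Classical in
theorem Lab.goodK [Infinite V] [Fintype E] (h : Lab q X ends C) (hq : 3 ≤ q) {T : Type} [Fintype T]
    {F : SimpleGraph T} {P : Finset T} {𝒟 : Set (Finset T)} (hG : Gad q T F P 𝒟)
    {K : Finset V} (hKX : K ⊆ X) (hK : K.card = q) :
    Good q (2 * Fintype.card T) X C (fun e => if ends e ⊆ K then 1 else 0) := by
  intro U U' hUU hc Z hZ
  have hd : q ≤ 2 * Fintype.card T := by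
    have := Finset.card_le_univ P
    rw [hG.card] at this
    omega
  obtain ⟨n, hn⟩ := h.fresh Z
  have s2 : U.biUnion C ⊆ Z := fun v hv => hZ (by
    exact Finset.mem_union_right _ (Finset.mem_union_left _ hv))
  have s3 : U'.biUnion C ⊆ Z := fun v hv => hZ (by
    exact Finset.mem_union_right _ (Finset.mem_union_right _ hv))
  set W := lab n (fun e => if ends e ⊆ K then 1 else 0) with hW
  have fr : ∀ u ∈ W, ∀ v ∈ C u, v ∈ Z → v ∈ X := by
    intro u hu
    exact hn u.1 u.2 (mem_lab.1 hu).1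
  have m1 : ∀ u ∈ W, u ∉ U := fun u hu => h.notMem hq s2 (fr u hu)
  have m2 : ∀ u ∈ W, u ∉ U' := fun u hu => h.notMem hq s3 (fr u hu)
  have wk : ∀ u, u ∈ W ↔ u.2 = n ∧ ends u.1 ⊆ K := by
    intro u
    rw [hW, mem_lab]
    split_ifs with hh <;> simp [hh] <;> omega
  refine h.glue hq hd (W := W) (W' := ∅) hUU (by simp) hZ (by simpa using fr) ?_ ?_
  · rw [Finset.union_empty]
    apply h.zero hG
    · intro u hu hu'
      rcases Finset.mem_union.1 hu' with h1 | h1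
      · exact hUU u hu h1
      · exact m1 u h1 hu
    · intro e
      rw [cnt_union (fun u hu hu' => m2 u hu' hu), hW, cnt_lab]
      have := hc e
      push_cast
      linarith
  · apply h.base hG hKX hK
    · intro u hu; exact ((wk u).1 hu).2
    · intro u hu u' hu' huu
      exact Prod.ext huu (((wk u).1 hu).1.trans ((wk u').1 hu').1.symm)
    · intro e he
      exact ⟨(e, n), (wk _).2 ⟨rfl, he⟩, rfl⟩

/-- Good functions as a subgroup. -/
def Lab.sub0 [Infinite V] [Fintype E] (h : Lab q X ends C) (hq : 3 ≤ q) {T : Type} [Fintype T]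
    {F : SimpleGraph T} {P : Finset T} {𝒟 : Set (Finset T)} (hG : Gad q T F P 𝒟) :
    AddSubgroup (E → ℤ) where
  carrier := {f | Good q (2 * Fintype.card T) X C f}
  zero_mem' := by
    intro U U' hUU hc
    apply h.zero hG U U' hUU
    intro e
    have := hc e
    simp only [Pi.zero_apply] at this
    linarith
  add_mem' := by
    intro f g hf hg
    refine h.add hq ?_ hf hg
    have := Finset.card_le_univ P
    rw [hG.card] at this
    omega
  neg_mem' := fun hf => Good.neg hf

end

section
variable {V : Type} [DecidableEq V] {Γ : Type} [AddCommGroup Γ]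

/-- pairs inside `K` -/
def pr (K : Finset V) : Finset (Sym2 V) := K.offDiag.image fun p => s(p.1, p.2)

theorem mem_pr {K : Finset V} {a b : V} : s(a, b) ∈ pr K ↔ a ∈ K ∧ b ∈ K ∧ a ≠ b := by
  simp only [pr, Finset.mem_image, Finset.mem_offDiag, Prod.exists, Sym2.eq_iff]
  constructor
  · rintro ⟨x, y, h, ⟨rfl, rfl⟩ | ⟨rfl, rfl⟩⟩
    · exact h
    · exact ⟨h.2.1, h.1, h.2.2.symm⟩
  · intro h; exact ⟨a, b, h, Or.inl ⟨rfl, rfl⟩⟩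

theorem card_pr (K : Finset V) : (pr K).card = K.card.choose 2 := by
  have := Sym2.card_image_offDiag K
  exact this

theorem sum_pr_insert (W : Sym2 V → Γ) {K : Finset V} {a : V} (ha : a ∉ K) :
    ∑ e ∈ pr (insert a K), W e = ∑ x ∈ K, W s(a, x) + ∑ e ∈ pr K, W e := by
  have h1 : pr (insert a K) = K.image (fun x => s(a, x)) ∪ pr K := by
    ext e
    induction e with
    | _ u v =>
      simp only [mem_pr, Finset.mem_union, Finset.mem_image, Finset.mem_insert, Sym2.eq_iff]
      grind
  have h2 : Disjoint (K.image (fun x => s(a, x))) (pr K) := by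
    rw [Finset.disjoint_left]
    intro e he he'
    obtain ⟨x, hx, rfl⟩ := Finset.mem_image.1 he
    exact ha (mem_pr.1 he').1
  rw [h1, Finset.sum_union h2, Finset.sum_image]
  intro x _ y _ hxy
  simp only [Sym2.eq_iff] at hxy
  grind

theorem deg_sum {h : V → Γ} {Y : Finset V} {M : Finset (Sym2 V)} (hM : M ⊆ pr Y) :
    ∑ x ∈ Y, (M.filter fun e => x ∈ e).card • h x =
      ∑ e ∈ M, ∑ x ∈ Y.filter (fun x => x ∈ e), h x := by
  have : ∀ x ∈ Y, (M.filter fun e => x ∈ e).card • h x =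
      ∑ e ∈ M, if x ∈ e then h x else 0 := by
    intro x _
    rw [← Finset.sum_filter, Finset.sum_const]
  rw [Finset.sum_congr rfl this, Finset.sum_comm]
  refine Finset.sum_congr rfl fun e _ => ?_
  rw [Finset.sum_filter]

theorem filter_pair {Y : Finset V} {a b : V} (ha : a ∈ Y) (hb : b ∈ Y) :
    Y.filter (fun x => x ∈ s(a, b)) = {a, b} := by
  ext x
  simp only [Finset.mem_filter, Sym2.mem_iff, Finset.mem_insert, Finset.mem_singleton]
  grind

theorem alg (W : Sym2 V → Γ) {q : ℕ} (hq : 3 ≤ q)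
    (hcl : ∀ K : Finset V, K.card = q → ∑ e ∈ pr K, W e = 0)
    {R Y : Finset V} (hR : R.card = q - 2) (hRY : ∀ v ∈ Y, v ∉ R) (hY : q + 1 ≤ Y.card)
    {M : Finset (Sym2 V)} (hM : M ⊆ pr Y) (hM1 : q.choose 2 ∣ M.card)
    (hM2 : ∀ x ∈ Y, q - 1 ∣ (M.filter fun e => x ∈ e).card) :
    ∑ e ∈ M, W e = 0 := by
  set h : V → Γ := fun a => - ∑ x ∈ R, W s(a, x) with hh
  set κ : Γ := ∑ e ∈ pr R, W e with hκ
  have key : ∀ a ∈ Y, ∀ b ∈ Y, a ≠ b → W s(a, b) = h a + h b - κ := by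
    intro a ha b hb hab
    have h1 : b ∉ R := hRY b hb
    have h2 : a ∉ insert b R := by
      rw [Finset.mem_insert, not_or]; exact ⟨hab, hRY a ha⟩
    have h3 := hcl (insert a (insert b R)) (by
      rw [Finset.card_insert_of_notMem h2, Finset.card_insert_of_notMem h1]; omega)
    rw [sum_pr_insert W h2, sum_pr_insert W h1, Finset.sum_insert h1] at h3
    simp only [hh, hκ]
    have := eq_neg_of_add_eq_zero_left h3
    rw [← sub_eq_zero, ← h3]
    abel
  have gen : ∀ M : Finset (Sym2 V), M ⊆ pr Y →
      ∑ e ∈ M, W e = ∑ x ∈ Y, (M.filter fun e => x ∈ e).card • h x - M.card • κ := by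
    intro M hM
    rw [deg_sum hM, ← Finset.sum_const, ← Finset.sum_sub_distrib]
    refine Finset.sum_congr rfl fun e he => ?_
    induction e with
    | _ a b =>
      obtain ⟨ha, hb, hab⟩ := mem_pr.1 (hM he)
      rw [filter_pair ha hb, Finset.sum_pair hab, key a ha b hb hab]
  have hs : ∀ M : Finset (Sym2 V), M ⊆ pr Y →
      ∑ x ∈ Y, (M.filter fun e => x ∈ e).card = 2 * M.card := by
    intro M hM
    have := deg_sum (h := fun _ => (1 : ℤ)) hM
    have h2 : ∀ e ∈ M, ∑ x ∈ Y.filter (fun x => x ∈ e), (1 : ℤ) = 2 := by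
      intro e he
      induction e with
      | _ a b =>
        obtain ⟨ha, hb, hab⟩ := mem_pr.1 (hM he)
        rw [filter_pair ha hb, Finset.sum_pair hab]; norm_num
    rw [Finset.sum_congr rfl h2] at this
    simp only [smul_eq_mul, mul_one, Finset.sum_const, nsmul_eq_mul] at this
    have h3 : ((∑ x ∈ Y, (M.filter fun e => x ∈ e).card : ℕ) : ℤ) = ((2 * M.card : ℕ) : ℤ) := by
      push_cast
      linarith
    exact_mod_cast h3
  have prK : ∀ K : Finset V, K ⊆ Y → pr K ⊆ pr Y := by
    intro K hK e
    induction e with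
    | _ a b =>
      rw [mem_pr, mem_pr]
      exact fun h => ⟨hK h.1, hK h.2.1, h.2.2⟩
  have degK : ∀ K : Finset V, ∀ x, ((pr K).filter fun e => x ∈ e).card =
      if x ∈ K then K.card - 1 else 0 := by
    intro K x
    split_ifs with hx
    · have : (pr K).filter (fun e => x ∈ e) = (K.erase x).image fun y => s(x, y) := by
        ext e
        induction e with
        | _ a b =>
          simp only [Finset.mem_filter, mem_pr, Finset.mem_image, Finset.mem_erase, Sym2.mem_iff,
            Sym2.eq_iff]
          grind
      rw [this, Finset.card_image_of_injOn, Finset.card_erase_of_mem hx]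
      intro a _ b _ hab
      simp only [Sym2.eq_iff] at hab
      grind
    · rw [Finset.card_eq_zero, Finset.filter_eq_empty_iff]
      intro e
      induction e with
      | _ a b =>
        rw [mem_pr, Sym2.mem_iff]
        rintro ⟨h1, h2, -⟩ (rfl | rfl) <;> contradiction
  have cl2 : ∀ K : Finset V, K ⊆ Y → K.card = q →
      ∑ x ∈ K, (q - 1) • h x = q.choose 2 • κ := by
    intro K hK hKq
    have h1 := hcl K hKq
    rw [gen _ (prK K hK), card_pr, hKq, sub_eq_zero] at h1
    rw [← h1]
    simp only [degK, hKq, ite_smul, zero_smul]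
    rw [← Finset.sum_filter]
    congr 1
    ext x
    simp only [Finset.mem_filter]
    exact ⟨fun hx => ⟨hK hx, hx⟩, fun hx => hx.2⟩
  have hconst : ∀ x ∈ Y, ∀ y ∈ Y, (q - 1) • h x = (q - 1) • h y := by
    intro x hx y hy
    by_cases hxy : x = y
    · rw [hxy]
    have hc : q - 1 ≤ ((Y.erase x).erase y).card := by
      rw [Finset.card_erase_of_mem (by simp [hy, Ne.symm hxy]), Finset.card_erase_of_mem hx]; omega
    obtain ⟨K, hK, hKc⟩ := Finset.exists_subset_card_eq hc
    have hKY : K ⊆ Y := fun v hv => Finset.mem_of_mem_erase (Finset.mem_of_mem_erase (hK hv))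
    have hxK : x ∉ K := fun hv => by
      have := hK hv
      simp at this
    have hyK : y ∉ K := fun hv => by
      have := hK hv
      simp at this
    have h1 := cl2 (insert x K) (Finset.insert_subset hx hKY) (by
      rw [Finset.card_insert_of_notMem hxK]; omega)
    have h2 := cl2 (insert y K) (Finset.insert_subset hy hKY) (by
      rw [Finset.card_insert_of_notMem hyK]; omega)
    rw [Finset.sum_insert hxK] at h1
    rw [Finset.sum_insert hyK, ← h1] at h2
    exact (add_right_cancel h2).symm
  obtain ⟨y0, hy0⟩ : Y.Nonempty := Finset.card_pos.1 (by omega)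
  set μ := (q - 1) • h y0 with hμ
  have hqμ : q • μ = q.choose 2 • κ := by
    obtain ⟨K, hK, hKc⟩ := Finset.exists_subset_card_eq (show q ≤ Y.card by omega)
    rw [← cl2 K hK hKc, Finset.sum_congr rfl fun x hx => hconst x (hK hx) y0 hy0,
      Finset.sum_const, hKc]
  obtain ⟨s, hs'⟩ := hM1
  choose! m hm using hM2
  have h1 : (q - 1) * ∑ x ∈ Y, m x = (q - 1) * (q * s) := by
    rw [Finset.mul_sum, ← Finset.sum_congr rfl hm, hs M hM, hs']
    have : q * (q - 1) = q.choose 2 * 2 := by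
      rw [Nat.choose_two_right]
      exact (Nat.div_mul_cancel (Nat.even_mul_pred_self q).two_dvd).symm
    calc 2 * (q.choose 2 * s) = (q.choose 2 * 2) * s := by ring
      _ = _ := by rw [← this]; ring
  have h2 : ∑ x ∈ Y, m x = q * s := Nat.eq_of_mul_eq_mul_left (by omega) h1
  rw [gen M hM, sub_eq_zero]
  have h3 : ∀ x ∈ Y, (M.filter fun e => x ∈ e).card • h x = m x • μ := by
    intro x hx
    rw [hm x hx, mul_comm, mul_smul, hconst x hx y0 hy0]
  rw [Finset.sum_congr rfl h3, ← Finset.sum_smul, h2, hs', mul_comm q s, mul_smul, hqμ,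
    mul_comm _ s, mul_smul]

end

open Classical in
theorem Lab.extract {q d : ℕ} {V E : Type} {X : Finset V} {ends : E → Finset V}
    {C : E × ℕ → Finset V} (h : Lab q X ends C) (hd : q ≤ d) {U : Finset (E × ℕ)}
    (lr : LRel q d X C U ∅) : ∃ (A : SimpleGraph V) (N : Finset V), Wit d X (gr X C U ⊔ A) N ∧
      KDec q (A ⊔ gr X C U) ∧ KDec q A ∧
      ∀ G : SimpleGraph V, (∀ v w, G.Adj v w → ∃ u ∈ U, v ∈ C u) → Dj A G := by
  have sub : U.biUnion C ⊆ X ∪ (U.biUnion C \ X) := by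
    intro v hv
    by_cases hvX : v ∈ X
    · exact Finset.mem_union_left _ hvX
    · exact Finset.mem_union_right _ (Finset.mem_sdiff.2 ⟨hv, hvX⟩)
  obtain ⟨A, N, w, k1, k2⟩ := lr (X ∪ (U.biUnion C \ X)) (by
    rw [Finset.biUnion_empty, Finset.union_empty]
    exact Finset.union_subset Finset.subset_union_left sub)
  have w0 := h.wit hd (subset_refl X) (U := U) (fun _ _ _ _ hv => hv)
  have e2 : A ⊔ gr X C ∅ = A := by
    show A ⊔ gsum ∅ _ = _
    rw [gsum_empty, sup_bot_eq]
  rw [e2] at k2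
  refine ⟨A, _, w0.union w, k1, k2, fun G hGU => w.dj ?_⟩
  intro v w hvw
  obtain ⟨u, hu, hv⟩ := hGU v w hvw
  exact sub (Finset.mem_biUnion.2 ⟨u, hu, hv⟩)

section
variable (X₀ : Type) [Fintype X₀] [DecidableEq X₀] (q : ℕ)

abbrev EE : Type := {e : Sym2 X₀ // ¬ e.IsDiag}

abbrev VV : Type := X₀ ⊕ ((EE X₀ × ℕ × Fin (q - 2)) ⊕ ℕ)

def XX : Finset (VV X₀ q) := Finset.univ.map Function.Embedding.inl

def endsE (e : EE X₀) : Finset (VV X₀ q) :=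
  (Finset.univ.filter fun x => x ∈ e.1).map Function.Embedding.inl

def CC (u : EE X₀ × ℕ) : Finset (VV X₀ q) :=
  endsE X₀ q u.1 ∪ Finset.univ.image fun t : Fin (q - 2) => Sum.inr (Sum.inl (u.1, u.2, t))

variable {X₀ q}

theorem inl_mem_endsE {e : EE X₀} {x : X₀} : (Sum.inl x : VV X₀ q) ∈ endsE X₀ q e ↔ x ∈ e.1 := by
  simp [endsE]

theorem inr_mem_endsE {e : EE X₀} {x} : (Sum.inr x : VV X₀ q) ∉ endsE X₀ q e := by
  simp [endsE]

theorem inl_mem_CC {u : EE X₀ × ℕ} {x : X₀} : (Sum.inl x : VV X₀ q) ∈ CC X₀ q u ↔ x ∈ u.1.1 := by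
  simp [CC, inl_mem_endsE]

theorem inr_mem_CC {u : EE X₀ × ℕ} {x} : (Sum.inr x : VV X₀ q) ∈ CC X₀ q u ↔
    ∃ t, x = Sum.inl (u.1, u.2, t) := by
  simp only [CC, Finset.mem_union, inr_mem_endsE, false_or, Finset.mem_image, Finset.mem_univ,
    true_and, Sum.inr.injEq]
  exact ⟨fun ⟨t, ht⟩ => ⟨t, ht.symm⟩, fun ⟨t, ht⟩ => ⟨t, ht.symm⟩⟩

theorem inl_mem_XX {x : X₀} : (Sum.inl x : VV X₀ q) ∈ XX X₀ q := by simp [XX]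

theorem inr_mem_XX {x} : (Sum.inr x : VV X₀ q) ∉ XX X₀ q := by simp [XX]

theorem endsE_card (e : EE X₀) : (endsE X₀ q e).card = 2 := by
  obtain ⟨e, he⟩ := e
  induction e with
  | _ a b =>
    have hab : a ≠ b := by simpa using he
    rw [endsE, Finset.card_map, filter_pair (by simp) (by simp), Finset.card_pair hab]

theorem theLab (hq : 3 ≤ q) : Lab q (XX X₀ q) (endsE X₀ q) (CC X₀ q) where
  card u := by
    rw [CC, Finset.card_union_of_disjoint, endsE_card, Finset.card_image_of_injective]
    · simp; omega
    · intro s t hst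
      simpa using hst
    · rw [Finset.disjoint_left]
      intro v hv hv'
      obtain ⟨t, -, rfl⟩ := Finset.mem_image.1 hv'
      exact inr_mem_endsE hv
  ecard := endsE_card
  esub e v hv := by
    rcases v with v | v
    · exact inl_mem_XX
    · exact (inr_mem_endsE hv).elim
  cap u v hv hX := by
    rcases v with v | v
    · exact inl_mem_endsE.2 (inl_mem_CC.1 hv)
    · exact (inr_mem_XX hX).elim
  sub u := Finset.subset_union_left
  inj e e' hee := by
    apply Subtype.ext
    apply Sym2.ext
    intro x
    rw [← inl_mem_endsE (q := q), hee, inl_mem_endsE]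
  surj x hx y hy hxy := by
    rcases x with x | x
    · rcases y with y | y
      · refine ⟨⟨s(x, y), ?_⟩, inl_mem_endsE.2 (by simp), inl_mem_endsE.2 (by simp)⟩
        simpa using hxy
      · exact (inr_mem_XX hy).elim
    · exact (inr_mem_XX hx).elim
  disj u u' v hv hv' hX := by
    rcases v with v | v
    · exact (hX inl_mem_XX).elim
    · obtain ⟨t, rfl⟩ := inr_mem_CC.1 hv
      obtain ⟨t', ht'⟩ := inr_mem_CC.1 hv'
      simp only [Sum.inl.injEq, Prod.mk.injEq] at ht'
      exact Prod.ext ht'.1 ht'.2.1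
  fresh Z := by
    refine ⟨(Z.sup fun v => match v with
      | Sum.inr (Sum.inl (_, k, _)) => k
      | _ => 0) + 1, ?_⟩
    intro e k hk v hv hvZ
    rcases v with v | v
    · exact inl_mem_XX
    · obtain ⟨t, rfl⟩ := inr_mem_CC.1 hv
      have := Finset.le_sup (f := fun v : VV X₀ q => match v with
        | Sum.inr (Sum.inl (_, k, _)) => k
        | _ => 0) hvZ
      simp only at this
      omega

open Classical in
theorem core1 (hq : 3 ≤ q) {T : Type} [Fintype T]
    {F : SimpleGraph T} {P : Finset T} {𝒟 : Set (Finset T)} (hG : Gad q T F P 𝒟)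
    {R Y : Finset X₀} (hR : R.card = q - 2) (hRY : ∀ v ∈ Y, v ∉ R) (hY : q + 1 ≤ Y.card)
    {M : Finset (Sym2 X₀)} (hM : M ⊆ pr Y) (hM1 : q.choose 2 ∣ M.card)
    (hM2 : ∀ x ∈ Y, q - 1 ∣ (M.filter fun e => x ∈ e).card) :
    Good q (2 * Fintype.card T) (XX X₀ q) (CC X₀ q) (fun e => if e.1 ∈ M then 1 else 0) := by
  set S := (theLab (X₀ := X₀) hq).sub0 hq hG with hS
  set W : Sym2 X₀ → (EE X₀ → ℤ) ⧸ S := fun e =>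
    QuotientAddGroup.mk' S (fun e' => if e'.1 = e then 1 else 0) with hW
  have hsum : ∀ M : Finset (Sym2 X₀), ∑ e ∈ M, W e =
      QuotientAddGroup.mk' S (fun e' => if e'.1 ∈ M then 1 else 0) := by
    intro M
    simp only [hW]
    rw [← map_sum]
    congr 1
    ext e'
    rw [Finset.sum_apply]
    simp
  have h0 : ∑ e ∈ M, W e = 0 := by
    refine alg W hq ?_ hR hRY hY hM hM1 (by convert hM2)
    intro K hK
    rw [hsum]
    refine (QuotientAddGroup.eq_zero_iff _).2 ?_
    have := (theLab (X₀ := X₀) hq).goodK hq hG (K := K.map Function.Embedding.inl) ?_ ?_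
    · show Good _ _ _ _ _
      convert this using 2
      rename_i e
      congr 1
      obtain ⟨e, he⟩ := e
      induction e with
      | _ a b =>
        have hab : a ≠ b := by simpa using he
        simp only [mem_pr, eq_iff_iff]
        constructor
        · rintro ⟨ha, hb, -⟩ v hv
          rcases v with v | v
          · rw [inl_mem_endsE, Sym2.mem_iff] at hv
            rcases hv with rfl | rfl <;> simpa
          · exact (inr_mem_endsE hv).elim
        · intro h1
          have ha := h1 (inl_mem_endsE.2 (Sym2.mem_mk_left a b))
          have hb := h1 (inl_mem_endsE.2 (Sym2.mem_mk_right a b))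
          exact ⟨by simpa using ha, by simpa using hb, hab⟩
    · intro v hv
      obtain ⟨x, -, rfl⟩ := Finset.mem_map.1 hv
      exact inl_mem_XX
    · rw [Finset.card_map, hK]
  rw [hsum] at h0
  exact (QuotientAddGroup.eq_zero_iff _).1 h0

open Classical in
theorem core2 (hq : 3 ≤ q) {d : ℕ} (hd : q ≤ d) {M : Finset (Sym2 X₀)} (hM : ∀ e ∈ M, ¬ e.IsDiag)
    (hg : Good q d (XX X₀ q) (CC X₀ q) (fun e => if e.1 ∈ M then 1 else 0)) :
    ∃ (A : SimpleGraph (VV X₀ q)) (N : Finset (VV X₀ q)), Wit d (XX X₀ q) A N ∧ KDec q A ∧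
      ∀ G : SimpleGraph (VV X₀ q), (∀ v w, G.Adj v w ↔ ∃ a b, s(a, b) ∈ M ∧ v = Sum.inl a ∧
        w = Sum.inl b) → KDec q (G ⊔ A) := by
  have h := theLab (X₀ := X₀) hq
  set U : Finset (EE X₀ × ℕ) := lab 0 (fun e => if e.1 ∈ M then 1 else 0) with hU
  have mU : ∀ u, u ∈ U ↔ u.2 = 0 ∧ u.1.1 ∈ M := by
    intro u
    rw [hU, mem_lab]
    split_ifs with hh <;> simp [hh]
  have lr := hg U ∅ (by simp) (by
    intro e
    rw [hU, cnt_lab]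
    simp [cnt])
  set X := XX X₀ q
  set C := CC X₀ q
  obtain ⟨A, N, w0, k1, k2, dj⟩ := h.extract hd lr
  refine ⟨_, _, w0, by rwa [sup_comm], ?_⟩
  intro G hGadj
  have e3 : G ⊔ (gr X C U ⊔ A) = (gsum U fun u => Vg ∅ (C u)) ⊔ A := by
    rw [← sup_assoc]
    congr 1
    ext v w
    rw [SimpleGraph.sup_adj, hGadj, gsum_adj, gsum_adj]
    constructor
    · rintro (⟨a, b, hab, rfl, rfl⟩ | ⟨u, hu, h1⟩)
      · refine ⟨(⟨s(a, b), hM _ hab⟩, 0), (mU _).2 ⟨rfl, hab⟩, ?_, inl_mem_CC.2 (by simp),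
          inl_mem_CC.2 (by simp), by simp⟩
        have := hM _ hab
        simpa using this
      · exact ⟨u, hu, h1.1, h1.2.1, h1.2.2.1, by simp⟩
    · rintro ⟨u, hu, h1, h2, h3, -⟩
      by_cases h4 : v ∈ X ∧ w ∈ X
      · left
        rcases v with v | v
        · rcases w with w | w
          · refine ⟨v, w, ?_, rfl, rfl⟩
            have hv := inl_mem_CC.1 h2
            have hw := inl_mem_CC.1 h3
            have hvw : v ≠ w := by rintro rfl; exact h1 rfl
            have := (Sym2.mem_and_mem_iff hvw).1 ⟨hv, hw⟩
            rw [← this]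
            exact ((mU u).1 hu).2
          · exact (inr_mem_XX h4.2).elim
        · exact (inr_mem_XX h4.1).elim
      · exact Or.inr ⟨u, hu, h1, h2, h3, h4⟩
  rw [e3]
  refine (KDec.gsum ?_ ?_).sup k2 (dj _ ?_).symm
  · intro u _
    exact KDec.clique _ (h.card u)
  · rintro u hu u' hu' huu v w ⟨h1, h2, h3, -⟩ ⟨-, h2', h3', -⟩
    apply huu
    by_cases hv : v ∈ X
    · by_cases hw : w ∈ X
      · apply Prod.ext
        · apply h.inj
          have : ∀ u : EE X₀ × ℕ, v ∈ C u → w ∈ C u → endsE X₀ q u.1 = {v, w} := by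
            intro u a b
            symm
            apply Finset.eq_of_subset_of_card_le
            · intro x hx
              simp only [Finset.mem_insert, Finset.mem_singleton] at hx
              rcases hx with rfl | rfl
              · exact h.cap u _ a hv
              · exact h.cap u _ b hw
            · rw [endsE_card, Finset.card_pair h1]
          rw [this u h2 h3, this u' h2' h3']
        · rw [((mU u).1 hu).1, ((mU u').1 hu').1]
      · exact h.disj u u' w h3 h3' hw
    · exact h.disj u u' v h2 h2' hv
  · rintro v w ⟨u, hu, hvw⟩
    exact ⟨u, hu, hvw.2.1⟩

end

abbrev X0 (q C₁ : ℕ) : Type := Fin C₁ ⊕ Fin (2 * q)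

def iot (q C₁ : ℕ) : Fin C₁ ↪ VV (X0 q C₁) q :=
  Function.Embedding.inl.trans Function.Embedding.inl

open Classical in
theorem core3 {q : ℕ} (hq : 3 ≤ q) {T : Type} [Fintype T]
    {F : SimpleGraph T} {P : Finset T} {𝒟 : Set (Finset T)} (hG : Gad q T F P 𝒟) {C₁ : ℕ}
    (L : SimpleGraph (Fin C₁)) (hL : IsKqDivisible q L) :
    ∃ (A : SimpleGraph (VV (X0 q C₁) q)) (N : Finset (VV (X0 q C₁) q)),
      Wit (2 * Fintype.card T) (XX (X0 q C₁) q) A N ∧ KDec q A ∧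
        KDec q (L.map (iot q C₁) ⊔ A) := by
  have hd : q ≤ 2 * Fintype.card T := by
    have := Finset.card_le_univ P
    rw [hG.card] at this
    omega
  set M : Finset (Sym2 (X0 q C₁)) := L.edgeFinset.image (Sym2.map Sum.inl) with hM
  have mM : ∀ a b, s(a, b) ∈ M ↔ ∃ x y, L.Adj x y ∧ a = Sum.inl x ∧ b = Sum.inl y := by
    intro a b
    simp only [hM, Finset.mem_image, SimpleGraph.mem_edgeFinset]
    constructor
    · rintro ⟨e, he, hab⟩
      induction e with
      | _ x y =>
        rw [Sym2.map_mk, Sym2.eq_iff] at hab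
        rcases hab with ⟨rfl, rfl⟩ | ⟨rfl, rfl⟩
        · exact ⟨x, y, he, rfl, rfl⟩
        · exact ⟨y, x, he.symm, rfl, rfl⟩
    · rintro ⟨x, y, hxy, rfl, rfl⟩
      exact ⟨s(x, y), hxy, rfl⟩
  have cM : M.card = L.edgeSet.ncard := by
    rw [hM, Finset.card_image_of_injective _ (Sym2.map.injective Sum.inl_injective),
      ← SimpleGraph.coe_edgeFinset, Set.ncard_coe_finset]
  have hMd : ∀ e ∈ M, ¬ e.IsDiag := by
    intro e
    induction e with
    | _ a b =>
      rw [mM]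
      rintro ⟨x, y, hxy, rfl, rfl⟩
      simpa using hxy.ne
  obtain ⟨R, hR, hRc⟩ := Finset.exists_subset_card_eq (s := (Finset.univ.map
    Function.Embedding.inr : Finset (X0 q C₁))) (n := q - 2) (by
      rw [Finset.card_map, Finset.card_univ, Fintype.card_fin]; omega)
  have hRl : ∀ x, (Sum.inl x : X0 q C₁) ∉ R := by
    intro x hx
    have := hR hx
    simp at this
  have g := core1 (X₀ := X0 q C₁) hq hG (R := R) (Y := Finset.univ \ R) (M := M) hRc (by simp) (by
    rw [Finset.card_sdiff_of_subset (by simp), Finset.card_univ, hRc]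
    simp only [Fintype.card_sum, Fintype.card_fin]; omega) (by
    intro e
    induction e with
    | _ a b =>
      intro h
      have h2 := hMd _ h
      rw [mM] at h
      obtain ⟨x, y, hxy, rfl, rfl⟩ := h
      rw [mem_pr]
      exact ⟨by simp [hRl], by simp [hRl], by simpa using h2⟩) (by
    rw [cM]; exact hL.1) (by
    intro x _
    rcases x with x | x
    · have : M.filter (fun e => Sum.inl x ∈ e) =
          (L.neighborFinset x).image fun y => s(Sum.inl x, Sum.inl y) := by
        ext e
        induction e with
        | _ a b =>
          simp only [Finset.mem_filter, mM, Finset.mem_image, SimpleGraph.mem_neighborFinset,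
            Sym2.mem_iff, Sym2.eq_iff]
          constructor
          · rintro ⟨⟨y, z, hyz, rfl, rfl⟩, h | h⟩
            · obtain rfl := Sum.inl_injective h
              exact ⟨z, hyz, Or.inl ⟨rfl, rfl⟩⟩
            · obtain rfl := Sum.inl_injective h
              exact ⟨y, hyz.symm, Or.inr ⟨rfl, rfl⟩⟩
          · rintro ⟨y, hy, ⟨rfl, rfl⟩ | ⟨rfl, rfl⟩⟩
            · exact ⟨⟨x, y, hy, rfl, rfl⟩, Or.inl rfl⟩
            · exact ⟨⟨y, x, hy.symm, rfl, rfl⟩, Or.inr rfl⟩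
      rw [this, Finset.card_image_of_injective]
      · have := hL.2 x
        rwa [← SimpleGraph.coe_neighborFinset, Set.ncard_coe_finset] at this
      · intro a b hab
        simp only [Sym2.eq_iff] at hab
        grind
    · have : M.filter (fun e => Sum.inr x ∈ e) = ∅ := by
        rw [Finset.filter_eq_empty_iff]
        intro e
        induction e with
        | _ a b =>
          rw [mM, Sym2.mem_iff]
          rintro ⟨y, z, hyz, rfl, rfl⟩
          simp
      rw [this]; simp)
  obtain ⟨A, N, w, k1, k2⟩ := core2 hq hd hMd g
  refine ⟨A, N, w, k1, k2 _ ?_⟩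
  intro v w
  rw [SimpleGraph.map_adj]
  constructor
  · rintro ⟨x, y, hxy, rfl, rfl⟩
    exact ⟨_, _, (mM _ _).2 ⟨x, y, hxy, rfl, rfl⟩, rfl, rfl⟩
  · rintro ⟨a, b, hab, rfl, rfl⟩
    obtain ⟨x, y, hxy, rfl, rfl⟩ := (mM _ _).1 hab
    exact ⟨x, y, hxy, rfl, rfl⟩

open Classical in
theorem core4 {q d C₁ : ℕ} (hq : 3 ≤ q) {V : Type} [Infinite V] {X N : Finset V}
    {A : SimpleGraph V} (L : SimpleGraph (Fin C₁)) (f : Fin C₁ ↪ V) (hf : ∀ x, f x ∈ X)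
    (w : Wit d X A N) (k1 : KDec q A) (k2 : KDec q (L.map f ⊔ A)) {n : ℕ}
    (hn : (N ∪ X).card ≤ n) :
    ∃ (φ : Fin C₁ ↪ Fin n) (A : SimpleGraph (Fin n)), IsAbsorber q (L.map φ) A (Set.range φ) ∧
        rootedDensity2 A (Set.range φ) ≤ 3 * d := by
  obtain ⟨t, ht, htc⟩ := Infinite.exists_superset_card_eq (N ∪ X) n hn
  have e : Fin n ≃ t := (t.equivFinOfCardEq htc).symm
  set j : Fin n ↪ V := e.toEmbedding.trans (Function.Embedding.subtype _) with hj
  have jr : ∀ v ∈ t, ∃ i, j i = v := by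
    intro v hv
    exact ⟨e.symm ⟨v, hv⟩, by simp [hj]⟩
  have hft : ∀ x, f x ∈ t := fun x => ht (Finset.mem_union_right _ (hf x))
  choose φ0 hφ0 using fun x => jr (f x) (hft x)
  set φ : Fin C₁ ↪ Fin n := ⟨φ0, fun x y hxy => f.injective (by rw [← hφ0, ← hφ0, hxy])⟩ with hφ
  have jφ : ∀ x, j (φ x) = f x := hφ0
  have eL : L.map φ = (L.map f).comap j := by
    ext u v
    simp only [SimpleGraph.map_adj, SimpleGraph.comap_adj]
    constructor
    · rintro ⟨x, y, hxy, rfl, rfl⟩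
      exact ⟨x, y, hxy, (jφ x).symm, (jφ y).symm⟩
    · rintro ⟨x, y, hxy, h1, h2⟩
      exact ⟨x, y, hxy, j.injective (by rw [jφ, h1]), j.injective (by rw [jφ, h2])⟩
  have eLA : L.map φ ⊔ A.comap j = (L.map f ⊔ A).comap j := by
    rw [eL]; ext u v; rfl
  have key : ∀ H' : (A.comap j).Subgraph,
      H'.edgeSet.ncard ≤ d * (H'.verts \ Set.range φ).ncard := by
    intro H'
    have hfin : H'.verts.Finite := Set.toFinite _
    set Tt := hfin.toFinset.map j with hTt
    have h1 := w.dens Tt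
    have h2 : H'.edgeSet.ncard ≤ {e | e ∈ A.edgeSet ∧ ∀ v ∈ e, v ∈ Tt}.ncard := by
      refine Set.ncard_le_ncard_of_injOn (Sym2.map j) ?_ (Sym2.map.injective j.injective).injOn
        (edges_in_finite A Tt)
      intro e
      induction e with
      | _ a b =>
        intro hab
        have hab' : H'.Adj a b := hab
        refine ⟨hab'.adj_sub, ?_⟩
        intro v hv
        rw [Sym2.map_mk, Sym2.mem_iff] at hv
        rcases hv with rfl | rfl
        · simp [hTt, hab'.fst_mem]
        · simp [hTt, hab'.snd_mem]
    have h3 : (Tt ∩ N).card ≤ (H'.verts \ Set.range φ).ncard := by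
      have : Tt ∩ N ⊆ (Set.toFinite (H'.verts \ Set.range φ)).toFinset.map j := by
        intro v hv
        obtain ⟨hv1, hv2⟩ := Finset.mem_inter.1 hv
        obtain ⟨i, hi, rfl⟩ := Finset.mem_map.1 hv1
        refine Finset.mem_map.2 ⟨i, ?_, rfl⟩
        rw [Set.Finite.mem_toFinset]
        refine ⟨by simpa using hi, ?_⟩
        rintro ⟨x, rfl⟩
        exact w.disj _ hv2 (by rw [jφ]; exact hf x)
      have h4 := Finset.card_le_card this
      rw [Finset.card_map] at h4
      rwa [Set.ncard_eq_toFinset_card _ (Set.toFinite _)]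
    exact h2.trans (h1.trans (Nat.mul_le_mul_left d h3))
  refine ⟨φ, A.comap j, ⟨?_, ?_, ?_, ?_⟩, ?_⟩
  · rintro u ⟨v, huv0⟩
    have huv : (L.map φ).Adj u v := huv0
    rw [SimpleGraph.map_adj] at huv
    obtain ⟨x, y, -, rfl, -⟩ := huv
    exact ⟨x, rfl⟩
  · rintro _ ⟨x, rfl⟩ _ ⟨y, rfl⟩ hxy
    rw [SimpleGraph.comap_adj, jφ, jφ] at hxy
    rcases w.touch _ _ hxy with h1 | h1
    · exact w.disj _ h1 (hf x)
    · exact w.disj _ h1 (hf y)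
  · refine KDec.comap (by omega) j k1 ?_
    intro u v huv
    exact jr u (ht (w.supp u v huv))
  · rw [eLA]
    refine KDec.comap (by omega) j k2 ?_
    rintro u v (huv | huv)
    · rw [SimpleGraph.map_adj] at huv
      obtain ⟨x, y, -, rfl, -⟩ := huv
      exact jr _ (hft x)
    · exact jr u (ht (w.supp u v huv))
  · have d0 : (0 : ℝ) ≤ d := Nat.cast_nonneg d
    refine max_le (Real.sSup_le ?_ (by positivity)) (Real.sSup_le ?_ (by positivity))
    · rintro _ ⟨H', hne, rfl⟩
      have h1 : 0 < (H'.verts \ Set.range φ).ncard := (Set.ncard_pos (Set.toFinite _)).2 hne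
      have h1' : (0 : ℝ) < (H'.verts \ Set.range φ).ncard := by exact_mod_cast h1
      rw [div_le_iff₀ h1']
      have h2 : (H'.edgeSet.ncard : ℝ) ≤ d * (H'.verts \ Set.range φ).ncard := by
        exact_mod_cast key H'
      nlinarith
    · rintro _ ⟨H', hne, rfl⟩
      have h3 : (3 : ℝ) ≤ H'.verts.ncard := by exact_mod_cast hne
      rw [div_le_iff₀ (by linarith)]
      have h2 : (H'.edgeSet.ncard : ℝ) ≤ d * (H'.verts \ Set.range φ).ncard := by
        exact_mod_cast key H'
      have h4 : ((H'.verts \ Set.range φ).ncard : ℝ) ≤ H'.verts.ncard := by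
        exact_mod_cast Set.ncard_le_ncard Set.diff_subset (Set.toFinite _)
      nlinarith

theorem upper (q : ℕ) (hq : 3 ≤ q) : ∃ r : ℝ, 0 < r ∧ AbsorbsAll q r := by
  classical
  obtain ⟨T, hT, F, P, 𝒟, hG⟩ := exists_gad q
  have hd : q ≤ 2 * Fintype.card T := by
    have := Finset.card_le_univ P
    rw [hG.card] at this
    omega
  refine ⟨3 * ((2 * Fintype.card T : ℕ) : ℝ), ?_, ?_⟩
  · have : 0 < 2 * Fintype.card T := by omega
    have : (0 : ℝ) < ((2 * Fintype.card T : ℕ) : ℝ) := by exact_mod_cast this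
    positivity
  · intro C₁ _
    have ex : ∀ L : SimpleGraph (Fin C₁), ∃ n0 : ℕ, IsKqDivisible q L → ∀ n, n0 ≤ n →
        ∃ (φ : Fin C₁ ↪ Fin n) (A : SimpleGraph (Fin n)),
          IsAbsorber q (L.map φ) A (Set.range φ) ∧
          rootedDensity2 A (Set.range φ) ≤ 3 * ((2 * Fintype.card T : ℕ) : ℝ) := by
      intro L
      by_cases hL : IsKqDivisible q L
      · obtain ⟨A, N, w, k1, k2⟩ := core3 hq hG L hL
        exact ⟨_, fun _ n hn => core4 hq L (iot q C₁) (fun x => inl_mem_XX) w k1 k2 hn⟩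
      · exact ⟨0, fun h => (hL h).elim⟩
    choose n0 hn0 using ex
    obtain ⟨B, hB⟩ := (Set.finite_range n0).bddAbove
    refine ⟨B + 1, by omega, fun L hL => hn0 L hL _ ?_⟩
    have := hB ⟨L, rfl⟩
    omega

theorem lowerCore {V : Type} [Fintype V] {q : ℕ} (hq : 3 ≤ q) {L A : SimpleGraph V} {R : Set V}
    (h : IsAbsorber q L A R) (htri : ∀ a b c, L.Adj a b → L.Adj a c → L.Adj b c → False)
    {x y : V} (hxy : L.Adj x y) :
    ∃ H' : A.Subgraph, (H'.verts \ R).Nonempty ∧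
      (q - 1) * (H'.verts \ R).ncard ≤ H'.edgeSet.ncard := by
  classical
  obtain ⟨hsup, hind, ⟨D1, hD1⟩, ⟨D2, hD2⟩⟩ := h
  rw [decomp_iff] at hD1 hD2
  have hL : ∀ u v, L.Adj u v → u ∈ R := fun u v huv => hsup ⟨v, huv⟩
  let G : SimpleGraph V :=
    { Adj := fun u v => A.Adj u v ∧ ∀ S, S ∈ D1 → S ∈ D2 → ¬ (u ∈ S ∧ v ∈ S)
      symm := ⟨fun u v huv => ⟨huv.1.symm, fun S h1 h2 h3 => huv.2 S h1 h2 h3.symm⟩⟩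
      loopless := ⟨fun _ huv => huv.1.ne rfl⟩ }
  have hG : ∀ u v, G.Adj u v ↔ A.Adj u v ∧ ∀ S, S ∈ D1 → S ∈ D2 → ¬ (u ∈ S ∧ v ∈ S) :=
    fun _ _ => Iff.rfl
  have nbr : ∀ S, S ∈ D1 → S ∉ D2 → ∀ v ∈ S, ∀ z ∈ S, v ≠ z → G.Adj v z := by
    intro S hS hS2 v hv z hz hvz
    have hadj := nclique_adj (hD1.1 S hS) hv hz hvz
    refine ⟨hadj, fun S' h1 h2 h3 => hS2 ?_⟩
    have := (hD1.2 v z hadj).unique ⟨h1, h3⟩ ⟨hS, hv, hz⟩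
    exact this ▸ h2
  have deg : ∀ v, v ∉ R → v ∈ G.support → 2 * (q - 1) ≤ G.degree v := by
    rintro v hvR ⟨u, hvu0⟩
    have hvu : G.Adj v u := hvu0
    obtain ⟨hA, hno⟩ := (hG v u).1 hvu
    obtain ⟨S1, ⟨hS1, hv1, hu1⟩, un1⟩ := hD1.2 v u hA
    have hS12 : S1 ∉ D2 := fun hh => hno S1 hS1 hh ⟨hv1, hu1⟩
    obtain ⟨S2, ⟨hS2, hv2, hu2⟩, -⟩ := hD2.2 v u (Or.inr hA)
    have hne : S2 ≠ S1 := by rintro rfl; exact hS12 hS2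
    have hns : ¬ S2 ⊆ S1 := fun hh => hne (Finset.eq_of_subset_of_card_le hh (by
      rw [(hD1.1 S1 hS1).2, (hD2.1 S2 hS2).2]))
    obtain ⟨w, hw2, hw1⟩ := Finset.not_subset.1 hns
    have hvw : v ≠ w := by rintro rfl; exact hw1 hv1
    have hadj2 := nclique_adj (hD2.1 S2 hS2) hv2 hw2 hvw
    have hadj : A.Adj v w := by
      rcases hadj2 with hh | hh
      · exact (hvR (hL v w hh)).elim
      · exact hh
    obtain ⟨S3, ⟨hS3, hv3, hw3⟩, -⟩ := hD1.2 v w hadj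
    have hS32 : S3 ∉ D2 := by
      intro hh
      have e1 := (hD2.2 v w hadj2).unique ⟨hh, hv3, hw3⟩ ⟨hS2, hv2, hw2⟩
      exact hne (un1 S2 ⟨e1 ▸ hS3, hv2, hu2⟩)
    have hdis : Disjoint (S1.erase v) (S3.erase v) := by
      rw [Finset.disjoint_left]
      intro z hz1 hz3
      rw [Finset.mem_erase] at hz1 hz3
      have ha := nclique_adj (hD1.1 S1 hS1) hv1 hz1.2 (Ne.symm hz1.1)
      have := (hD1.2 v z ha).unique ⟨hS1, hv1, hz1.2⟩ ⟨hS3, hv3, hz3.2⟩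
      exact hw1 (this ▸ hw3)
    have hsub : S1.erase v ∪ S3.erase v ⊆ G.neighborFinset v := by
      intro z hz
      rw [SimpleGraph.mem_neighborFinset]
      rcases Finset.mem_union.1 hz with hz | hz <;> rw [Finset.mem_erase] at hz
      · exact nbr S1 hS1 hS12 v hv1 z hz.2 (Ne.symm hz.1)
      · exact nbr S3 hS3 hS32 v hv3 z hz.2 (Ne.symm hz.1)
    have := Finset.card_le_card hsub
    rw [Finset.card_union_of_disjoint hdis, Finset.card_erase_of_mem hv1,
      Finset.card_erase_of_mem hv3, (hD1.1 S1 hS1).2, (hD1.1 S3 hS3).2,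
      SimpleGraph.card_neighborFinset_eq_degree] at this
    omega
  refine ⟨{ verts := G.support, Adj := G.Adj, adj_sub := fun h => h.1,
            edge_vert := fun h => ⟨_, h⟩, symm := G.symm }, ?_, ?_⟩
  · obtain ⟨S, ⟨hS, hx, hy⟩, -⟩ := hD2.2 x y (Or.inl hxy)
    have hxR := hL x y hxy
    have hyR := hL y x hxy.symm
    obtain ⟨z, hz, hzn⟩ : ∃ z ∈ S, z ∉ ({x, y} : Finset V) := by
      by_contra hcon
      push Not at hcon
      have h1 := Finset.card_le_card (fun z hz => hcon z hz : S ⊆ {x, y})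
      have h2 := Finset.card_le_two (a := x) (b := y)
      rw [(hD2.1 S hS).2] at h1
      omega
    simp only [Finset.mem_insert, Finset.mem_singleton, not_or] at hzn
    have hzx := nclique_adj (hD2.1 S hS) hz hx hzn.1
    have hzy := nclique_adj (hD2.1 S hS) hz hy hzn.2
    have hzR : z ∉ R := by
      intro hzR
      have h1 : L.Adj z x := hzx.resolve_right (hind z hzR x hxR)
      have h2 : L.Adj z y := hzy.resolve_right (hind z hzR y hyR)
      exact htri z x y h1 h2 hxy
    refine ⟨z, ⟨x, ?_⟩, hzR⟩
    refine (hG z x).2 ⟨hzx.resolve_left fun hh => hzR (hL _ _ hh), ?_⟩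
    intro S' h1 h2 h3
    have := (hD2.2 z x hzx).unique ⟨h2, h3⟩ ⟨hS, hz, hx⟩
    subst this
    exact hind x hxR y hyR (nclique_adj (hD1.1 S' h1) hx hy hxy.ne)
  · show (q - 1) * (G.support \ R).ncard ≤ G.edgeSet.ncard
    rw [← SimpleGraph.coe_edgeFinset, Set.ncard_coe_finset,
      Set.ncard_eq_toFinset_card _ (Set.toFinite _)]
    have h1 := G.sum_degrees_eq_twice_card_edges
    set N := (Set.toFinite (G.support \ R)).toFinset with hN
    have h2 : ∑ v ∈ N, G.degree v ≤ ∑ v, G.degree v :=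
      Finset.sum_le_sum_of_subset (Finset.subset_univ _)
    have h3 : N.card • (2 * (q - 1)) ≤ ∑ v ∈ N, G.degree v := by
      apply Finset.card_nsmul_le_sum
      intro v hv
      rw [hN, Set.Finite.mem_toFinset] at hv
      exact deg v hv.2 hv.1
    rw [smul_eq_mul] at h3
    have h4 : N.card * (2 * (q - 1)) = 2 * ((q - 1) * N.card) := by ring
    omega

def bip (n : ℕ) : SimpleGraph (Fin (n + n)) where
  Adj i j := ¬ (i.val < n ↔ j.val < n)
  symm := ⟨fun _ _ h => fun h' => h h'.symm⟩
  loopless := ⟨fun _ h => h Iff.rfl⟩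

theorem bip_deg (n : ℕ) (i : Fin (n + n)) : ((bip n).neighborSet i).ncard = n := by
  by_cases hi : i.val < n
  · have : (bip n).neighborSet i = Fin.natAdd n '' (Set.univ : Set (Fin n)) := by
      ext j
      simp only [SimpleGraph.mem_neighborSet, bip, hi, true_iff, Set.image_univ, Set.mem_range]
      constructor
      · intro hj
        exact ⟨⟨j.val - n, by omega⟩, Fin.ext (by simp; omega)⟩
      · rintro ⟨k, rfl⟩; simp
    rw [this, Set.ncard_image_of_injective _ (Fin.natAdd_injective n n), Set.ncard_univ,
      Nat.card_fin]
  · have : (bip n).neighborSet i = Fin.castAdd n '' (Set.univ : Set (Fin n)) := by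
      ext j
      simp only [SimpleGraph.mem_neighborSet, bip, hi, false_iff, Set.image_univ, Set.mem_range,
        not_not]
      constructor
      · intro hj
        exact ⟨⟨j.val, hj⟩, Fin.ext rfl⟩
      · rintro ⟨k, rfl⟩; simp
    rw [this, Set.ncard_image_of_injective _ (Fin.castAdd_injective n n), Set.ncard_univ,
      Nat.card_fin]

theorem bip_edges (n : ℕ) : (bip n).edgeSet.ncard = n * n := by
  classical
  have h1 := (bip n).sum_degrees_eq_twice_card_edges
  have h2 : ∀ v, (bip n).degree v = n := by
    intro v
    rw [← SimpleGraph.card_neighborFinset_eq_degree, ← Set.ncard_coe_finset,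
      SimpleGraph.coe_neighborFinset, bip_deg]
  simp only [h2, Finset.sum_const, Finset.card_univ, Fintype.card_fin, smul_eq_mul] at h1
  rw [← SimpleGraph.coe_edgeFinset, Set.ncard_coe_finset]
  have : (n + n) * n = 2 * (n * n) := by ring
  omega

theorem lower (q : ℕ) (hq : 3 ≤ q) (r : ℝ) (h : AbsorbsAll q r) : (q : ℝ) - 1 ≤ r := by
  set n := q * (q - 1) with hn
  have hn0 : 0 < n := Nat.mul_pos (by omega) (by omega)
  obtain ⟨C₂, -, hC⟩ := h (n + n) (by omega)
  have hdiv : IsKqDivisible q (bip n) := by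
    constructor
    · rw [bip_edges]
      refine Dvd.dvd.mul_right ⟨2, ?_⟩ n
      rw [Nat.choose_two_right, hn]
      exact (Nat.div_mul_cancel (Nat.even_mul_pred_self q).two_dvd).symm
    · intro v
      rw [bip_deg]
      exact Dvd.intro_left q rfl
  obtain ⟨φ, A, hA, hr⟩ := hC _ hdiv
  have hadj : (bip n).Adj ⟨0, by omega⟩ ⟨n, by omega⟩ := by
    simp [bip, hn0]
  obtain ⟨H', hne, he⟩ := lowerCore hq hA (by
    intro a b c hab hac hbc
    rw [SimpleGraph.map_adj] at hab hac hbc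
    obtain ⟨x, y, h1, rfl, rfl⟩ := hab
    obtain ⟨x', z, h2, h3, rfl⟩ := hac
    obtain ⟨y', z', h4, h5, h6⟩ := hbc
    obtain rfl := φ.injective h3
    obtain rfl := φ.injective h5
    obtain rfl := φ.injective h6
    simp only [bip] at h1 h2 h4
    tauto) ((SimpleGraph.map_adj _ _ _ _).2 ⟨_, _, hadj, rfl, rfl⟩)
  have hpos : (0 : ℝ) < (H'.verts \ Set.range φ).ncard := by
    exact_mod_cast (Set.ncard_pos (Set.toFinite _)).2 hne
  have h1 : (q : ℝ) - 1 ≤ (H'.edgeSet.ncard : ℝ) / ((H'.verts \ Set.range φ).ncard : ℝ) := by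
    rw [le_div_iff₀ hpos]
    have : (((q - 1) * (H'.verts \ Set.range φ).ncard : ℕ) : ℝ) ≤ (H'.edgeSet.ncard : ℝ) := by
      exact_mod_cast he
    push_cast [Nat.cast_sub (show 1 ≤ q by omega)] at this
    exact this
  refine h1.trans (le_trans ?_ ((le_max_left _ _).trans hr))
  refine le_csSup ?_ ⟨H', hne, rfl⟩
  refine ⟨(A.edgeSet.ncard : ℝ), ?_⟩
  rintro _ ⟨K, hK, rfl⟩
  have hK1 : (1 : ℝ) ≤ (K.verts \ Set.range φ).ncard := by
    exact_mod_cast (Set.ncard_pos (Set.toFinite _)).2 hK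
  refine (div_le_self (Nat.cast_nonneg _) hK1).trans ?_
  exact_mod_cast Set.ncard_le_ncard K.edgeSet_subset (Set.toFinite _)

/-- For each integer `q ≥ 3`, `d_abs(K_q) ≥ q - 1`. -/
theorem absorberThreshold_lower_bound (q : ℕ) (hq : 3 ≤ q) :
    (q : ℝ) - 1 ≤ absorberThreshold q := by
  obtain ⟨r, hr⟩ := upper q hq
  exact le_csInf ⟨r, hr⟩ fun s hs => lower q hq s hs.2
end
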